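/- Under Assumptions A, B and C, the constrained stochastic game possesses a Nash equilibrium in the set Φ of stationary multi-strategies. -/

import Mathlib

open MeasureTheory ProbabilityTheory Filter Topology
open scoped ENNReal NNReal

namespace CSGame

/-- The joint action space of the players. -/
abbrev JA {n : ℕ} (A : Fin n → Type) : Type := (i : Fin n) → A i

/-- The data of a constrained discounted stochastic Markov game:
countable state space `X`, Borel action spaces `A i` with compact admissible
action sets `As i x`, transition probability `p`, initial distribution `η`,
discount factor `α`, cost/constraint functions `c i ℓ` (`ℓ = 0` is the cost,
`ℓ ∈ L = {1,…,l}` are the constraints) and constraint bounds `κ i ℓ`. -/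
structure GameData (n l : ℕ) (X : Type) (A : Fin n → Type)
    [MeasurableSpace X] [∀ i, MeasurableSpace (A i)] [∀ i, TopologicalSpace (A i)] where
  As : (i : Fin n) → X → Set (A i)
  p : X → JA A → Measure X
  η : Measure X
  α : ℝ
  c : Fin n → Fin (l + 1) → X → JA A → ℝ
  κ : Fin n → Fin (l + 1) → ℝ
  hAs_ne : ∀ i x, (As i x).Nonempty
  hAs_cpt : ∀ i x, IsCompact (As i x)
  hp : ∀ x a, IsProbabilityMeasure (p x a)
  hpm : ∀ x y, Measurable fun a => p x a {y}
  hη : IsProbabilityMeasure η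
  hα0 : 0 < α
  hα1 : α < 1
  hc : ∀ i ℓ x, Measurable (c i ℓ x)

variable {n l : ℕ}
variable {X : Type} [Countable X] [MeasurableSpace X] [DiscreteMeasurableSpace X]
  [TopologicalSpace X] [DiscreteTopology X] [BorelSpace X] [SecondCountableTopology X]
variable {A : Fin n → Type} [∀ i, MeasurableSpace (A i)] [∀ i, TopologicalSpace (A i)]
  [∀ i, PolishSpace (A i)] [∀ i, BorelSpace (A i)]

/-- The set of feasible action profiles in state `x` (the section of `𝕂` at `x`). -/
def jointSet (G : GameData n l X A) (x : X) : Set (JA A) :=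
  Set.univ.pi fun i => G.As i x

/-- Histories of the game: `Hist X AA t` records the initial state and `t`
state-action transitions, ending with the current state (this is `H^{t+1}`). -/
def Hist (X AA : Type) : ℕ → Type
  | 0 => X
  | t + 1 => Hist X AA t × AA × X

noncomputable instance histMS (X AA : Type) [MeasurableSpace X] [MeasurableSpace AA] :
    ∀ t, MeasurableSpace (Hist X AA t)
  | 0 => inferInstanceAs (MeasurableSpace X)
  | t + 1 =>
      letI := histMS X AA t
      inferInstanceAs (MeasurableSpace (Hist X AA t × AA × X))

/-- The current (last) state of a history. -/
def lastState (X AA : Type) : ∀ t, Hist X AA t → X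
  | 0, h => h
  | _ + 1, h => h.2.2

theorem measurable_lastState (X AA : Type) [MeasurableSpace X] [MeasurableSpace AA] :
    ∀ t, Measurable (lastState X AA t)
  | 0 => measurable_id
  | _ + 1 => measurable_snd.comp measurable_snd

variable (G : GameData n l X A)

/-- A (history dependent, randomised) strategy of player `i`: a sequence of
transition probabilities from histories to the action space of player `i`,
concentrated on the admissible action set at the current state. -/
structure Strategy (i : Fin n) where
  f : ∀ t, Hist X (JA A) t → ProbabilityMeasure (A i)
  meas : ∀ t (s : Set (A i)), MeasurableSet s →
    Measurable fun h => (f t h : Measure (A i)) s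
  supp : ∀ t h, f t h (G.As i (lastState X (JA A) t h)) = 1

/-- A stationary strategy of player `i`: a transition probability from states to
actions, concentrated on the admissible action set. -/
def Stat (i : Fin n) : Type :=
  {φ : X → ProbabilityMeasure (A i) // ∀ x, φ x (G.As i x) = 1}

noncomputable instance (i : Fin n) : TopologicalSpace (Stat G i) :=
  inferInstanceAs (TopologicalSpace
    {φ : X → ProbabilityMeasure (A i) // ∀ x, φ x (G.As i x) = 1})

/-- Multi-strategies: one strategy for each player. -/
abbrev MultiStrategy : Type _ := ∀ i, Strategy G i

/-- Stationary multi-strategies (the set `Φ`). -/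
abbrev StatProfile : Type _ := ∀ i, Stat G i

noncomputable instance : TopologicalSpace (StatProfile G) :=
  inferInstanceAs (TopologicalSpace (∀ i, Stat G i))

/-- The strategy induced by a stationary strategy. -/
noncomputable def ofStat (i : Fin n) (φ : Stat G i) : Strategy G i where
  f := fun t h => φ.1 (lastState X (JA A) t h)
  meas := fun t _s _hs =>
    (Measurable.of_discrete (f := fun x => (φ.1 x : Measure (A i)) _s)).comp
      (measurable_lastState X (JA A) t)
  supp := fun t h => φ.2 _

/-- The multi-strategy induced by a stationary multi-strategy. -/
noncomputable def ofStatAll (φ : StatProfile G) : MultiStrategy G :=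
  fun i => ofStat G i (φ i)

/-- `[π_{-i}, σ]` : player `i` deviates to `σ`, the others keep `π`. -/
noncomputable def combine (π : MultiStrategy G) (i : Fin n) (σ : Strategy G i) :
    MultiStrategy G :=
  Function.update π i σ

/-- `[φ_{-i}, γ]` for stationary profiles. -/
noncomputable def updStat (φ : StatProfile G) (i : Fin n) (γ : Stat G i) :
    StatProfile G :=
  Function.update φ i γ

/-- The joint (product) distribution of the players' actions after history `h`. -/
noncomputable def jointLaw (π : MultiStrategy G) (t : ℕ) (h : Hist X (JA A) t) :
    Measure (JA A) :=
  Measure.pi fun i => ((π i).f t h : Measure (A i))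

/-- The distribution of histories of length `t` under the multi-strategy `π`,
the transition probability `G.p` and the initial distribution `η'`
(the finite-dimensional marginals of the Ionescu–Tulcea measure `P^π_{η'}`). -/
noncomputable def histMeas (η' : Measure X) (π : MultiStrategy G) :
    ∀ t, Measure (Hist X (JA A) t)
  | 0 => η'
  | t + 1 =>
      (histMeas η' π t).bind fun h =>
        (jointLaw G π t h).bind fun a =>
          (G.p (lastState X (JA A) t h) a).map fun y =>
            (show Hist X (JA A) (t + 1) from (h, a, y))

/-- Expected value of `f (x^{t+1}, a^{t+1})` under `π` (states enumerated from `1`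
in the paper, from `0` here). -/
noncomputable def stageExp (η' : Measure X) (π : MultiStrategy G) (t : ℕ)
    (f : X → JA A → ℝ) : ℝ :=
  ∫ h, (∫ a, f (lastState X (JA A) t h) a ∂(jointLaw G π t h)) ∂(histMeas G η' π t)

/-- The expected discounted cost functional
`J(π) = (1-α) E^π_{η'} [∑_{t≥1} α^{t-1} f(x^t,a^t)]`. -/
noncomputable def Jfun (η' : Measure X) (f : X → JA A → ℝ) (π : MultiStrategy G) : ℝ :=
  (1 - G.α) * ∑' t : ℕ, G.α ^ t * stageExp G η' π t f

/-- `J_i^ℓ(π)` of the paper. -/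
noncomputable def J (i : Fin n) (ℓ : Fin (l + 1)) (π : MultiStrategy G) : ℝ :=
  Jfun G G.η (G.c i ℓ) π

/-- `π_i ∈ Δ_i(π_{-i})` : all constraints of player `i` are satisfied. -/
def Feas (i : Fin n) (π : MultiStrategy G) : Prop :=
  ∀ ℓ : Fin (l + 1), ℓ ≠ 0 → J G i ℓ π ≤ G.κ i ℓ

/-- Expectation of `w(x^{t+1})` (as an extended nonnegative real). -/
noncomputable def wStateExp (η' : Measure X) (π : MultiStrategy G) (t : ℕ)
    (w : X → ℝ) : ℝ≥0∞ :=
  ∫⁻ h, ENNReal.ofReal (w (lastState X (JA A) t h)) ∂(histMeas G η' π t)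

/-- Assumption A(i): continuity of the transition probability in the actions. -/
def AssumptionA1 : Prop :=
  ∀ x y, ContinuousOn (fun a => G.p x a {y}) (jointSet G x)

/-- Assumption A: continuity of the transition probability and of the
cost/constraint functions in the actions. -/
def AssumptionA : Prop :=
  AssumptionA1 G ∧ ∀ i ℓ x, ContinuousOn (G.c i ℓ x) (jointSet G x)

/-- Assumption B for the weight function `w`: `w ≥ 1` bounds all the costs on `𝕂`,
the discounted tails `sup_π (1-α) E^π_η[∑_{t≥k} α^{t-1} w(x^t)]` vanish as `k → ∞`,
and for each stage `t` the family `{w(x^t)}` is uniformly integrable over all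
multi-strategies. -/
def AssumptionB (w : X → ℝ) : Prop :=
  (∀ x, 1 ≤ w x) ∧
  (∀ i ℓ x a, a ∈ jointSet G x → |G.c i ℓ x a| ≤ w x) ∧
  Tendsto (fun k : ℕ => ⨆ π : MultiStrategy G,
      ENNReal.ofReal (1 - G.α) *
        ∑' t : ℕ, ENNReal.ofReal G.α ^ (k + t) * wStateExp G G.η π (k + t) w)
    atTop (𝓝 0) ∧
  ∀ t : ℕ, Tendsto (fun k : ℕ => ⨆ π : MultiStrategy G,
      ∫⁻ h in {h | (k : ℝ) ≤ w (lastState X (JA A) t h)},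
        ENNReal.ofReal (w (lastState X (JA A) t h)) ∂(histMeas G G.η π t))
    atTop (𝓝 0)

/-- Assumption C (Slater condition). -/
def AssumptionC : Prop :=
  ∀ (φ : StatProfile G) (i : Fin n), ∃ π : Strategy G i,
    ∀ ℓ : Fin (l + 1), ℓ ≠ 0 → J G i ℓ (combine G (ofStatAll G φ) i π) < G.κ i ℓ

/-- Assumption D: the initial distribution charges every state. -/
def AssumptionD : Prop :=
  ∀ x : X, 0 < G.η {x}

/-- Assumption W (weighted-norm conditions of Wessels). -/
def AssumptionW (w : X → ℝ) : Prop :=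
  (∀ x, 1 ≤ w x) ∧
  (∀ i ℓ x a, a ∈ jointSet G x → |G.c i ℓ x a| ≤ w x) ∧
  (∃ δ : ℝ, 1 ≤ δ ∧ δ * G.α < 1 ∧ ∀ x a, a ∈ jointSet G x →
      ∫⁻ y, ENNReal.ofReal (w y) ∂(G.p x a) ≤ ENNReal.ofReal (δ * w x)) ∧
  (∀ x, ContinuousOn (fun a => ∫⁻ y, ENNReal.ofReal (w y) ∂(G.p x a)) (jointSet G x)) ∧
  (∫⁻ y, ENNReal.ofReal (w y) ∂G.η) < ⊤

/-- All cost and constraint functions are bounded. -/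
def BoundedCosts : Prop :=
  ∀ i (ℓ : Fin (l + 1)), ∃ C : ℝ, ∀ x a, |G.c i ℓ x a| ≤ C

/-- A stationary multi-strategy `φ` is a Nash equilibrium of the constrained game:
it is feasible, and no player can lower his discounted cost by a unilateral
deviation to any (history dependent) strategy satisfying his constraints. -/
def IsNashStat (φ : StatProfile G) : Prop :=
  (∀ i, Feas G i (ofStatAll G φ)) ∧
  ∀ (i : Fin n) (σ : Strategy G i), Feas G i (combine G (ofStatAll G φ) i σ) →
    J G i 0 (ofStatAll G φ) ≤ J G i 0 (combine G (ofStatAll G φ) i σ)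

section Occupation

/-- A correlated strategy of the players. -/
structure CorrStrategy where
  f : ∀ t, Hist X (JA A) t → ProbabilityMeasure (JA A)
  meas : ∀ t (s : Set (JA A)), MeasurableSet s →
    Measurable fun h => (f t h : Measure (JA A)) s
  supp : ∀ t h, f t h (jointSet G (lastState X (JA A) t h)) = 1

/-- History distributions under a correlated strategy. -/
noncomputable def histMeasC (π : CorrStrategy G) : ∀ t, Measure (Hist X (JA A) t)
  | 0 => G.η
  | t + 1 =>
      (histMeasC π t).bind fun h =>
        ((π.f t h : Measure (JA A))).bind fun a =>
          (G.p (lastState X (JA A) t h) a).map fun y =>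
            (show Hist X (JA A) (t + 1) from (h, a, y))

/-- The occupation measure `ρ(K') = (1-α) E^π_η [∑_{t≥1} α^{t-1} 1_{K'}(x^t,a^t)]`
of a correlated strategy, as a measure on the state–action pairs. -/
noncomputable def occ (π : CorrStrategy G) : Measure (X × JA A) :=
  ENNReal.ofReal (1 - G.α) •
    Measure.sum fun t : ℕ => ENNReal.ofReal G.α ^ t •
      ((histMeasC G π t).bind fun h =>
        (π.f t h : Measure (JA A)).map fun a => (lastState X (JA A) t h, a))

/-- The set `𝓜` of occupation measures of correlated strategies. -/
def OccSet : Set (ProbabilityMeasure (X × JA A)) :=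
  {ρ | ∃ π : CorrStrategy G, (ρ : Measure (X × JA A)) = occ G π}

/-- Projection of a state–action pair onto the coordinates of player `i`. -/
def projAct (i : Fin n) : X × JA A → X × A i := fun q => (q.1, q.2 i)

/-- The set `𝓜_i` of statewise projections of occupation measures onto `𝕂_i`. -/
def MiSet (i : Fin n) : Set (ProbabilityMeasure (X × A i)) :=
  {μ | ∃ ρ ∈ OccSet G, (μ : Measure (X × A i)) = (ρ : Measure (X × JA A)).map (projAct i)}

/-- The marginal `μ̂(x) = μ({x} × A_i(x))`. -/
noncomputable def marg (i : Fin n) (μ : ProbabilityMeasure (X × A i)) (x : X) : ℝ≥0∞ :=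
  (μ : Measure (X × A i)) ({x} ×ˢ G.As i x)

/-- `μ = μ̂ φ` : `φ` disintegrates `μ`, i.e. `μ({x} × B) = φ(B|x) μ̂(x)`. -/
def Disint (i : Fin n) (μ : ProbabilityMeasure (X × A i)) (φ : Stat G i) : Prop :=
  ∀ x (B : Set (A i)), MeasurableSet B → B ⊆ G.As i x →
    (μ : Measure (X × A i)) ({x} ×ˢ B) = (φ.1 x B : ℝ≥0∞) * marg G i μ x

/-- The occupation measure on state–action pairs of a multi-strategy. -/
noncomputable def occMulti (η' : Measure X) (π : MultiStrategy G) : Measure (X × JA A) :=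
  ENNReal.ofReal (1 - G.α) •
    Measure.sum fun t : ℕ => ENNReal.ofReal G.α ^ t •
      ((histMeas G η' π t).bind fun h =>
        (jointLaw G π t h).map fun a => (lastState X (JA A) t h, a))

end Occupation

section COP

/-- The product distribution on action profiles in state `x` in which player `i`
plays the fixed action `ai` and every player `j ≠ i` plays `φ j`. -/
noncomputable def statJoint (φ : StatProfile G) (i : Fin n) (x : X) (ai : A i) :
    Measure (JA A) :=
  Measure.pi fun j =>
    if h : j = i then Measure.dirac (cast (congrArg A h.symm) ai)
    else ((φ j).1 x : Measure (A j))

/-- `c_i^ℓ(x, [φ_{-i}(x), a_i])`. -/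
noncomputable def cbar (φ : StatProfile G) (i : Fin n) (ℓ : Fin (l + 1)) (x : X)
    (ai : A i) : ℝ :=
  ∫ a, G.c i ℓ x a ∂(statJoint G φ i x ai)

/-- `p(y | x, [φ_{-i}(x), a_i])`. -/
noncomputable def pbar (φ : StatProfile G) (i : Fin n) (y x : X) (ai : A i) : ℝ≥0∞ :=
  ∫⁻ a, G.p x a {y} ∂(statJoint G φ i x ai)

/-- Feasibility in the constrained optimisation problem `COP(φ_{-i})`:
`μ ∈ Pr(𝕂_i)` satisfies the constraint inequalities and the characteristic
equations of occupation measures. -/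
def COPFeasible (φ : StatProfile G) (i : Fin n)
    (μ : ProbabilityMeasure (X × A i)) : Prop :=
  (μ : Measure (X × A i)) {q : X × A i | q.2 ∈ G.As i q.1} = 1 ∧
  (∀ ℓ : Fin (l + 1), ℓ ≠ 0 →
    ∫ q : X × A i, cbar G φ i ℓ q.1 q.2 ∂(μ : Measure (X × A i)) ≤ G.κ i ℓ) ∧
  ∀ x : X, (μ : Measure (X × A i)) ({x} ×ˢ G.As i x) =
    ENNReal.ofReal (1 - G.α) * G.η {x} +
      ENNReal.ofReal G.α *
        ∫⁻ q : X × A i, pbar G φ i x q.1 q.2 ∂(μ : Measure (X × A i))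

/-- The objective of `COP(φ_{-i})`. -/
noncomputable def COPObj (φ : StatProfile G) (i : Fin n)
    (μ : ProbabilityMeasure (X × A i)) : ℝ :=
  ∫ q : X × A i, cbar G φ i 0 q.1 q.2 ∂(μ : Measure (X × A i))

/-- The solution set `𝓞_i(φ_{-i})` of `COP(φ_{-i})`. -/
def COPSol (φ : StatProfile G) (i : Fin n) : Set (ProbabilityMeasure (X × A i)) :=
  {μ | COPFeasible G φ i μ ∧
    ∀ ν, COPFeasible G φ i ν → COPObj G φ i μ ≤ COPObj G φ i ν}

end COP

section Perturbed

/-- `η̃` is a probability measure charging exactly the `η`-null states `X_0`. -/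
def IsPerturb (ηt : Measure X) : Prop :=
  IsProbabilityMeasure ηt ∧ (∀ x, G.η {x} = 0 → 0 < ηt {x}) ∧
    ∀ x, G.η {x} ≠ 0 → ηt {x} = 0

/-- The perturbed initial distribution `η(m) = (1 - 1/m) η + (1/m) η̃`. -/
noncomputable def etam (ηt : Measure X) (m : ℕ) : Measure X :=
  ENNReal.ofReal (1 - 1 / (m : ℝ)) • G.η + ENNReal.ofReal (1 / (m : ℝ)) • ηt

/-- The truncation `c_i^{ℓ,m}` of `c_i^ℓ` at the level `√m`. -/
noncomputable def ctrunc (i : Fin n) (ℓ : Fin (l + 1)) (m : ℕ) (x : X) (a : JA A) : ℝ :=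
  max (-Real.sqrt m) (min (G.c i ℓ x a) (Real.sqrt m))

/-- `J_i^{ℓ,η(m)}`: discounted cost with truncated costs and perturbed initial
distribution. -/
noncomputable def Jm (ηt : Measure X) (m : ℕ) (i : Fin n) (ℓ : Fin (l + 1))
    (π : MultiStrategy G) : ℝ :=
  Jfun G (etam G ηt m) (ctrunc G i ℓ m) π

/-- The perturbed constraint bounds `κ_i^{ℓ,m} = (1 - 1/m) κ_i^ℓ + 1/√m`. -/
noncomputable def kappam (i : Fin n) (ℓ : Fin (l + 1)) (m : ℕ) : ℝ :=
  (1 - 1 / (m : ℝ)) * G.κ i ℓ + 1 / Real.sqrt m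

/-- `π_i ∈ Δ_i^m(π_{-i})` : the constraints of the `m`-CSG hold. -/
def FeasM (ηt : Measure X) (m : ℕ) (i : Fin n) (π : MultiStrategy G) : Prop :=
  ∀ ℓ : Fin (l + 1), ℓ ≠ 0 → Jm G ηt m i ℓ π ≤ kappam G i ℓ m

end Perturbed

end CSGame

open MeasureTheory ProbabilityTheory Filter Topology
open scoped ENNReal NNReal

namespace BrouwerAux

theorem det_interp {E : Type*} [NormedAddCommGroup E] [NormedSpace ℝ E] [FiniteDimensional ℝ E]
    (t0 : ℝ) (ht0 : 0 < t0) :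
    ∃ (s : Finset ℝ) (c : ℝ → ℝ), (∀ t ∈ s, 0 < t ∧ t < t0) ∧
      ∀ D : E →L[ℝ] E, (ContinuousLinearMap.id ℝ E + D).det =
        ∑ t ∈ s, c t * (ContinuousLinearMap.id ℝ E + t • D).det := by
  classical
  obtain ⟨s, hs, hcard⟩ := (Set.Ioo_infinite ht0).exists_subset_card_eq
    (Module.finrank ℝ E + 1)
  refine ⟨s, fun t => (Lagrange.basis s id t).eval 1, fun t ht => hs ht, fun D => ?_⟩
  let b := Module.finBasis ℝ E
  let M := LinearMap.toMatrix b b (D : E →ₗ[ℝ] E)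
  let P : Polynomial ℝ :=
    Matrix.det ((Polynomial.X : Polynomial ℝ) • M.map Polynomial.C + (1 : Matrix _ _ ℝ).map Polynomial.C)
  have hP : ∀ t : ℝ, (ContinuousLinearMap.id ℝ E + t • D).det = P.eval t := by
    intro t
    have : P.eval t = Matrix.det (t • M + 1) := by
      simp only [P, ← Polynomial.coe_evalRingHom, RingHom.map_det]
      congr 1
      ext i j
      simp [Matrix.one_apply]
      split_ifs <;> simp [mul_comm]
    rw [this, ContinuousLinearMap.det, ← LinearMap.det_toMatrix b]
    congr 1
    simp [M, add_comm]
  have hdeg : P.degree < s.card := by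
    rw [hcard]
    refine lt_of_le_of_lt Polynomial.degree_le_natDegree ?_
    have := Polynomial.natDegree_det_X_add_C_le M (1 : Matrix _ _ ℝ)
    rw [Fintype.card_fin] at this
    exact_mod_cast Nat.lt_succ_of_le this
  have h1 := Lagrange.eq_interpolate (v := id) (s := s) (f := P) (Set.injOn_id _) hdeg
  have h2 : (ContinuousLinearMap.id ℝ E + D).det = P.eval 1 := by
    rw [← hP]; simp
  rw [h2]
  conv_lhs => rw [h1]
  rw [Lagrange.interpolate_apply, Polynomial.eval_finsetSum]
  refine Finset.sum_congr rfl fun t _ => ?_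
  rw [hP]; simp [mul_comm]

theorem no_retraction {E : Type*} [NormedAddCommGroup E] [InnerProductSpace ℝ E]
    [FiniteDimensional ℝ E] (r : E → E) (R : ℝ) (hR : 0 < R)
    (hr : ContDiff ℝ 1 r) (h1 : ∀ x, ‖r x‖ = R) (h2 : ∀ x, ‖x‖ = R → r x = x) : False := by
  borelize E
  let μ : Measure E := Measure.addHaar
  let B := Metric.ball (0 : E) R
  let g : E → E := fun x => r x - x
  have hg : ContDiff ℝ 1 g := hr.sub contDiff_id
  have hgd : ∀ x, HasStrictFDerivAt g (fderiv ℝ g x) x := fun x =>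
    hg.contDiffAt.hasStrictFDerivAt one_ne_zero
  have hcg : Continuous (fderiv ℝ g) := hg.continuous_fderiv one_ne_zero
  obtain ⟨C, hC⟩ := (isCompact_closedBall (0 : E) R).exists_bound_of_continuousOn
    hcg.continuousOn
  have hC0 : 0 ≤ C := (norm_nonneg _).trans (hC 0 (by simp [hR.le]))
  have hlip : ∀ x ∈ Metric.closedBall (0 : E) R, ∀ y ∈ Metric.closedBall (0 : E) R,
      ‖g x - g y‖ ≤ C * ‖x - y‖ := fun x hx y hy =>
    (convex_closedBall (0:E) R).norm_image_sub_le_of_norm_fderiv_le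
      (fun x _ => (hgd x).hasFDerivAt.differentiableAt) hC hy hx
  obtain ⟨δ, hδ, hdet⟩ : ∃ δ > 0, ∀ T : E →L[ℝ] E, ‖T‖ < δ →
      0 < (ContinuousLinearMap.id ℝ E + T).det := by
    have hcont : Continuous fun T : E →L[ℝ] E => (ContinuousLinearMap.id ℝ E + T).det :=
      ContinuousLinearMap.continuous_det.comp (by fun_prop)
    have h0 : (0:ℝ) < (ContinuousLinearMap.id ℝ E + (0 : E →L[ℝ] E)).det := by
      simp [ContinuousLinearMap.det]
    have := (hcont.tendsto 0).eventually (lt_mem_nhds h0)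
    obtain ⟨δ, hδ, h⟩ := Metric.eventually_nhds_iff.1 this
    exact ⟨δ, hδ, fun T hT => h (by simpa using hT)⟩
  let t0 : ℝ := min 1 (min 1 δ / (C + 1))
  have ht0 : 0 < t0 := by positivity
  obtain ⟨s, c, hs, hc⟩ := det_interp (E := E) t0 ht0
  have key : ∀ t, 0 < t → t < t0 →
      ∫ x in B, (ContinuousLinearMap.id ℝ E + t • fderiv ℝ g x).det ∂μ = μ.real B := by
    intro t htp htl
    have ht1 : t < 1 := htl.trans_le (min_le_left _ _)
    have htC : t * (C + 1) < min 1 δ := by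
      have := htl.trans_le (min_le_right _ _)
      rwa [lt_div_iff₀ (by positivity)] at this
    have htC1 : t * C < 1 := by
      have := htC.trans_le (min_le_left _ _); nlinarith
    have htCδ : t * C < δ := by
      have := htC.trans_le (min_le_right _ _); nlinarith
    let f : E → E := fun x => x + t • g x
    have hfd : ∀ x, HasStrictFDerivAt f (ContinuousLinearMap.id ℝ E + t • fderiv ℝ g x) x :=
      fun x => (hasStrictFDerivAt_id x).add ((hgd x).const_smul t)
    have hpos : ∀ x ∈ Metric.closedBall (0:E) R,
        0 < (ContinuousLinearMap.id ℝ E + t • fderiv ℝ g x).det := by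
      intro x hx
      apply hdet
      rw [norm_smul, Real.norm_of_nonneg htp.le]
      exact (mul_le_mul_of_nonneg_left (hC x hx) htp.le).trans_lt htCδ
    have hinj : Set.InjOn f (Metric.closedBall (0:E) R) := by
      intro x hx y hy hxy
      have h3 : x - y = t • (g y - g x) := by
        have : x + t • g x = y + t • g y := hxy
        rw [smul_sub, sub_eq_sub_iff_add_eq_add, this, add_comm]
      have h4 : ‖x - y‖ ≤ t * C * ‖x - y‖ := by
        conv_lhs => rw [h3, norm_smul, Real.norm_of_nonneg htp.le]
        rw [mul_assoc, norm_sub_rev x y]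
        exact mul_le_mul_of_nonneg_left (hlip y hy x hx) htp.le
      have h5 : ‖x - y‖ = 0 := by
        by_contra hne
        have : 0 < ‖x - y‖ := lt_of_le_of_ne (norm_nonneg _) (Ne.symm hne)
        nlinarith
      exact sub_eq_zero.1 (norm_eq_zero.1 h5)
    have hsub : f '' B ⊆ B := by
      rintro _ ⟨x, hx, rfl⟩
      have hx' : ‖x‖ < R := by simpa [B] using hx
      have : f x = (1 - t) • x + t • r x := by simp only [f, g]; module
      have h6 : ‖f x‖ ≤ (1 - t) * ‖x‖ + t * R := by
        rw [this]
        refine (norm_add_le _ _).trans ?_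
        rw [norm_smul, norm_smul, h1, Real.norm_of_nonneg htp.le,
          Real.norm_of_nonneg (by linarith)]
      have : ‖f x‖ < R := by nlinarith
      simpa [B] using this
    have hBsub : B ⊆ Metric.closedBall (0:E) R := Metric.ball_subset_closedBall
    have hopen : IsOpen (f '' B) := by
      rw [isOpen_iff_mem_nhds]
      rintro _ ⟨x, hx, rfl⟩
      have hsurj : (ContinuousLinearMap.id ℝ E + t • fderiv ℝ g x).range = ⊤ := by
        have := (hpos x (hBsub hx)).ne'
        exact LinearMap.range_eq_top.2 ((LinearMap.equivOfDetNeZero _ this).surjective)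
      rw [← (hfd x).map_nhds_eq_of_surj hsurj]
      exact Filter.image_mem_map (Metric.isOpen_ball.mem_nhds hx)
    have hfc : Continuous f := by
      have := hg.continuous
      fun_prop
    have hB : B ⊆ f '' B := by
      refine (convex_ball (0:E) R).isPreconnected.subset_of_closure_inter_subset hopen ?_ ?_
      · exact ⟨f 0, hsub ⟨0, by simp [B, hR], rfl⟩, ⟨0, by simp [B, hR], rfl⟩⟩
      · rintro z ⟨hz, hzB⟩
        have hcl : IsClosed (f '' Metric.closedBall (0:E) R) :=
          ((isCompact_closedBall (0:E) R).image hfc).isClosed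
        obtain ⟨x, hx, rfl⟩ := closure_minimal (Set.image_mono hBsub) hcl hz
        refine ⟨x, ?_, rfl⟩
        have hx' : ‖x‖ ≤ R := by simpa using hx
        rcases hx'.lt_or_eq with h | h
        · simpa [B] using h
        · exfalso
          have : f x = x := by simp [f, g, h2 x h]
          rw [this] at hzB
          simp at hzB; linarith
    have himg : f '' B = B := Set.Subset.antisymm hsub hB
    have := integral_image_eq_integral_abs_det_fderiv_smul μ (s := B) (f := f)
      (f' := fun x => ContinuousLinearMap.id ℝ E + t • fderiv ℝ g x) measurableSet_ball
      (fun x _ => (hfd x).hasFDerivAt.hasFDerivWithinAt) (hinj.mono hBsub) (fun _ => (1:ℝ))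
    rw [himg] at this
    simp only [smul_eq_mul, mul_one, integral_const, measureReal_restrict_apply_univ] at this
    rw [this]
    refine setIntegral_congr_fun measurableSet_ball fun x hx => ?_
    exact (abs_of_pos (hpos x (hBsub hx))).symm
  have hzero : ∀ x, (ContinuousLinearMap.id ℝ E + fderiv ℝ g x).det = 0 := by
    intro x
    have hrd : HasFDerivAt r (ContinuousLinearMap.id ℝ E + fderiv ℝ g x) x := by
      have h := (hasFDerivAt_id x).add (hgd x).hasFDerivAt
      have he : (id + g) = r := by funext y; simp [g]
      rwa [he] at h
    by_contra hne
    obtain ⟨v, hv⟩ := (LinearMap.equivOfDetNeZero _ hne).surjective (r x)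
    have hv : (ContinuousLinearMap.id ℝ E + fderiv ℝ g x) v = r x := hv
    have h7 := (hrd.inner ℝ hrd)
    have h8 : (fun y => inner ℝ (r y) (r y)) = fun _ => R ^ 2 := by
      funext y; rw [real_inner_self_eq_norm_sq, h1]
    rw [h8] at h7
    have h9 := h7.unique (hasFDerivAt_const (R ^ 2) x)
    have h10 := congrArg (fun L => L v) h9
    simp [fderivInnerCLM_apply] at h10
    have hv' : v + (fderiv ℝ g x) v = r x := by simpa using hv
    rw [hv', real_inner_self_eq_norm_sq, h1] at h10
    nlinarith
  have hIntg : ∀ t : ℝ, IntegrableOn (fun x => (ContinuousLinearMap.id ℝ E + t • fderiv ℝ g x).det) B μ := by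
    intro t
    have hcont : Continuous fun x => (ContinuousLinearMap.id ℝ E + t • fderiv ℝ g x).det :=
      ContinuousLinearMap.continuous_det.comp (by fun_prop)
    exact (hcont.continuousOn.integrableOn_compact (isCompact_closedBall (0:E) R)).mono_set
      Metric.ball_subset_closedBall
  have hsum1 : ∑ t ∈ s, c t = 1 := by
    have := hc 0
    simpa [ContinuousLinearMap.det] using this.symm
  have hfin : (0:ℝ) = μ.real B := by
    calc (0:ℝ) = ∫ x in B, (ContinuousLinearMap.id ℝ E + fderiv ℝ g x).det ∂μ := by simp [hzero]
      _ = ∫ x in B, ∑ t ∈ s, c t * (ContinuousLinearMap.id ℝ E + t • fderiv ℝ g x).det ∂μ := by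
          simp_rw [← hc]
      _ = ∑ t ∈ s, c t * ∫ x in B, (ContinuousLinearMap.id ℝ E + t • fderiv ℝ g x).det ∂μ := by
          rw [integral_finsetSum _ fun t _ => (hIntg t).const_mul _]
          simp_rw [integral_const_mul]
      _ = ∑ t ∈ s, c t * μ.real B :=
          Finset.sum_congr rfl fun t ht => by rw [key t (hs t ht).1 (hs t ht).2]
      _ = μ.real B := by rw [← Finset.sum_mul, hsum1, one_mul]
  have hpos : 0 < μ B := Metric.measure_ball_pos μ 0 hR
  have : 0 < μ.real B := ENNReal.toReal_pos hpos.ne' measure_ball_lt_top.ne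
  linarith

theorem smooth_fixed {E : Type*} [NormedAddCommGroup E] [InnerProductSpace ℝ E]
    [FiniteDimensional ℝ E] (f : E → E) (R : ℝ) (hR : 0 < R) (hf : ContDiff ℝ 1 f)
    (hb : ∀ x, ‖f x‖ < R) : ∃ x, f x = x := by
  by_contra hno
  push Not at hno
  let χ : ContDiffBump (0 : E) := ⟨R, R + 1, hR, by linarith⟩
  let h : E → E := fun x => x - χ x • f x
  have hne : ∀ x, h x ≠ 0 := by
    intro x hx
    have hx1 : x = χ x • f x := sub_eq_zero.1 hx
    have hle : ‖x‖ < R := by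
      rw [hx1, norm_smul, Real.norm_of_nonneg χ.nonneg]
      have h1 := χ.le_one (x := x)
      have h2 := hb x
      have := norm_nonneg (f x)
      nlinarith [χ.nonneg (x := x)]
    have : χ x = 1 := χ.one_of_mem_closedBall (by simpa [χ] using hle.le)
    rw [this, one_smul] at hx1
    exact hno x hx1.symm
  have hh : ContDiff ℝ 1 h := contDiff_id.sub (χ.contDiff.smul hf)
  have hR1 : 0 < R + 1 := by linarith
  refine no_retraction (fun x => ((R + 1) * ‖h x‖⁻¹) • h x) (R + 1) hR1 ?_ ?_ ?_
  · exact (contDiff_const.mul ((hh.norm ℝ hne).inv fun x => norm_ne_zero_iff.2 (hne x))).smul hh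
  · intro x
    have := norm_pos_iff.2 (hne x)
    rw [norm_smul, Real.norm_of_nonneg (by positivity)]
    field_simp
  · intro x hx
    have : χ x = 0 := χ.zero_of_le_dist (by simp [χ, hx])
    have h1 : h x = x := by simp [h, this]
    simp only [h1, hx]
    rw [mul_inv_cancel₀ hR1.ne', one_smul]

theorem brouwer_inner {E : Type*} [NormedAddCommGroup E] [InnerProductSpace ℝ E]
    [FiniteDimensional ℝ E] (f : E → E) (R : ℝ) (hf : Continuous f)
    (hb : ∀ x, ‖f x‖ ≤ R) : ∃ x, f x = x := by
  have hR : 0 ≤ R := (norm_nonneg _).trans (hb 0)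
  have hap : ∀ k : ℕ, ∃ x : E, ‖x‖ ≤ R + 1 ∧ ‖f x - x‖ ≤ 1 / ((k : ℝ) + 1) := by
    intro k
    have hk : (0:ℝ) < 1 / ((k : ℝ) + 1) := by positivity
    have hk1 : 1 / ((k : ℝ) + 1) ≤ 1 := by
      rw [div_le_one (by positivity)]; linarith [Nat.cast_nonneg (α := ℝ) k]
    obtain ⟨g, hg, hgf, -⟩ := hf.exists_contDiff_approx 1 (ε := fun _ => 1 / ((k : ℝ) + 1))
      continuous_const (fun _ => hk)
    have hgR : ∀ x, ‖g x‖ < R + 1 := by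
      intro x
      have h1 := hgf x
      rw [dist_eq_norm] at h1
      have := norm_le_norm_add_norm_sub' (g x) (f x)
      linarith [hb x]
    obtain ⟨x, hx⟩ := smooth_fixed g (R + 1) (by linarith) (by exact_mod_cast hg) hgR
    refine ⟨x, by rw [← hx]; exact (hgR x).le, ?_⟩
    have h1 := hgf x
    rw [dist_eq_norm, hx, norm_sub_rev] at h1
    exact h1.le
  choose x hx hfx using hap
  obtain ⟨a, -, φ, hφ, hlim⟩ := (isCompact_closedBall (0:E) (R + 1)).tendsto_subseq
    (x := x) (fun k => by simpa using hx k)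
  refine ⟨a, ?_⟩
  have h1 : Tendsto (fun k => ‖f (x (φ k)) - x (φ k)‖) atTop (𝓝 ‖f a - a‖) :=
    (((hf.tendsto a).comp hlim).sub hlim).norm
  have h2 : Tendsto (fun k => ‖f (x (φ k)) - x (φ k)‖) atTop (𝓝 0) :=
    squeeze_zero (fun _ => norm_nonneg _) (fun k => hfx (φ k))
      (tendsto_one_div_add_atTop_nhds_zero_nat.comp hφ.tendsto_atTop)
  have := tendsto_nhds_unique h1 h2
  exact sub_eq_zero.1 (norm_eq_zero.1 this)

/-- A continuous self-map of `ℝ^ι` with bounded range has a fixed point. -/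
theorem brouwer {ι : Type*} [Fintype ι] (f : (ι → ℝ) → (ι → ℝ)) (R : ℝ) (hf : Continuous f)
    (hb : ∀ x i, |f x i| ≤ R) : ∃ x, f x = x := by
  let e := EuclideanSpace.equiv ι ℝ
  have hbd : ∃ R', ∀ x : EuclideanSpace ℝ ι, ‖e.symm (f (e x))‖ ≤ R' := by
    have hcpt : IsCompact (Set.pi Set.univ fun _ : ι => Set.Icc (-R) R) :=
      isCompact_univ_pi fun _ => isCompact_Icc
    obtain ⟨C, hC⟩ := hcpt.exists_bound_of_continuousOn e.symm.continuous.continuousOn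
    refine ⟨C, fun x => hC _ fun i _ => abs_le.1 (hb _ i)⟩
  obtain ⟨R', hR'⟩ := hbd
  obtain ⟨x, hx⟩ := brouwer_inner (fun x => e.symm (f (e x))) R'
    (e.symm.continuous.comp (hf.comp e.continuous)) hR'
  refine ⟨e x, ?_⟩
  have := congrArg e hx
  simpa using this

end BrouwerAux


namespace NashAux

open Finset

/-- Retraction of a real vector onto the simplex. -/
noncomputable def sretr {F : Type*} [Fintype F] (v : F → ℝ) (a : F) : ℝ :=
  (max (v a) 0 + max (1 - ∑ b, max (v b) 0) 0 / Fintype.card F) / max 1 (∑ b, max (v b) 0)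

lemma sretr_nonneg {F : Type*} [Fintype F] (v : F → ℝ) (a : F) : 0 ≤ sretr v a := by
  unfold sretr; positivity

lemma sretr_sum {F : Type*} [Fintype F] [Nonempty F] (v : F → ℝ) : ∑ a, sretr v a = 1 := by
  unfold sretr
  rw [← Finset.sum_div, Finset.sum_add_distrib, Finset.sum_const, Finset.card_univ, nsmul_eq_mul,
    mul_div_cancel₀ _ (by exact_mod_cast Fintype.card_ne_zero)]
  rw [div_eq_one_iff_eq (by positivity)]
  rcases le_total (∑ b, max (v b) 0) 1 with h | h
  · rw [max_eq_left h, max_eq_left (by linarith)]; ring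
  · rw [max_eq_right h, max_eq_right (by linarith)]; ring

lemma sretr_eq {F : Type*} [Fintype F] (v : F → ℝ) (h0 : ∀ a, 0 ≤ v a) (h1 : ∑ a, v a = 1) :
    sretr v = v := by
  funext a
  unfold sretr
  simp [max_eq_left (h0 _), h1]

lemma sretr_cont {F : Type*} [Fintype F] (a : F) : Continuous fun v : F → ℝ => sretr v a := by
  unfold sretr
  refine Continuous.div ?_ ?_ ?_
  · fun_prop
  · fun_prop
  · intro v; positivity

lemma nash_gain {F : Type*} [Fintype F] (u g : F → ℝ) (h0 : ∀ a, 0 ≤ u a) (h1 : ∑ a, u a = 1)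
    (hfix : ∀ a, u a = (u a + max (∑ b, u b * g b - g a) 0) /
      (1 + ∑ c, max (∑ b, u b * g b - g c) 0)) (a : F) : ∑ b, u b * g b ≤ g a := by
  set m := ∑ b, u b * g b with hm
  set D := ∑ c, max (m - g c) 0 with hD
  have hD0 : 0 ≤ D := Finset.sum_nonneg fun c _ => le_max_right _ _
  obtain ⟨c, hc1, hc2⟩ : ∃ c, 0 < u c ∧ m ≤ g c := by
    by_contra hcon
    push Not at hcon
    have hle : ∀ b, u b * g b ≤ u b * m := by
      intro b
      rcases (h0 b).eq_or_lt with hb | hb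
      · simp [← hb]
      · exact mul_le_mul_of_nonneg_left (hcon b hb).le (h0 b)
    obtain ⟨c, hc⟩ : ∃ c, 0 < u c := by
      by_contra hcc
      push Not at hcc
      have : ∑ a, u a ≤ 0 := Finset.sum_nonpos fun a _ => hcc a
      linarith
    have : ∑ b, u b * g b < ∑ b, u b * m :=
      Finset.sum_lt_sum (fun b _ => hle b) ⟨c, Finset.mem_univ _, by
        exact mul_lt_mul_of_pos_left (hcon c hc) hc⟩
    rw [← Finset.sum_mul, h1, ← hm] at this
    linarith
  have h2 := hfix c
  rw [max_eq_right (by linarith), add_zero, eq_div_iff (by positivity)] at h2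
  have hDz : D = 0 := by
    have : u c * D = 0 := by linarith
    rcases mul_eq_zero.1 this with h | h
    · exact absurd h hc1.ne'
    · exact h
  have := (Finset.sum_eq_zero_iff_of_nonneg (fun c _ => le_max_right (m - g c) 0)).1 hDz a
    (Finset.mem_univ _)
  have h3 := le_max_left (m - g a) 0
  linarith

theorem nash_abstract {Q : Type*} [Fintype Q] {F : Q → Type*} [∀ q, Fintype (F q)]
    [∀ q, Nonempty (F q)] {R : Type*} [Fintype R]
    (g : ∀ q, F q → (∀ q, F q → ℝ) → (R → ℝ) → ℝ)
    (hg : ∀ q a, Continuous fun z : (∀ q, F q → ℝ) × (R → ℝ) => g q a z.1 z.2)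
    (T : R → (∀ q, F q → ℝ) → (R → ℝ) → ℝ)
    (hT : ∀ r, Continuous fun z : (∀ q, F q → ℝ) × (R → ℝ) => T r z.1 z.2)
    (C : ℝ) (hC : 0 ≤ C)
    (hbd : ∀ (u : ∀ q, F q → ℝ) (W : R → ℝ), (∀ q a, 0 ≤ u q a) → (∀ q, ∑ a, u q a = 1) →
      (∀ r, |W r| ≤ C) → ∀ r, |T r u W| ≤ C) :
    ∃ (u : ∀ q, F q → ℝ) (W : R → ℝ), (∀ q a, 0 ≤ u q a) ∧ (∀ q, ∑ a, u q a = 1) ∧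
      (∀ r, |W r| ≤ C) ∧ (∀ r, W r = T r u W) ∧
      ∀ q a, ∑ b, u q b * g q b u W ≤ g q a u W := by
  classical
  let clip : ℝ → ℝ := fun s => max (-C) (min s C)
  have hclip : ∀ s, |clip s| ≤ C := by
    intro s
    rw [abs_le]
    exact ⟨le_max_left _ _, max_le (by linarith) (min_le_right _ _)⟩
  have hclip2 : ∀ s, |s| ≤ C → clip s = s := by
    intro s hs
    rw [abs_le] at hs
    simp only [clip]
    rw [min_eq_left hs.2, max_eq_right hs.1]
  let U : ((Σ q, F q) ⊕ R → ℝ) → (∀ q, F q → ℝ) := fun v q => sretr fun a => v (Sum.inl ⟨q, a⟩)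
  let Wf : ((Σ q, F q) ⊕ R → ℝ) → (R → ℝ) := fun v r => clip (v (Sum.inr r))
  have hU : Continuous U := by
    refine continuous_pi fun q => continuous_pi fun a => ?_
    have h1 : Continuous fun (v : (Σ q, F q) ⊕ R → ℝ) (b : F q) => v (Sum.inl ⟨q, b⟩) :=
      continuous_pi fun b => continuous_apply _
    exact (sretr_cont a).comp h1
  have hW : Continuous Wf := by
    refine continuous_pi fun r => ?_
    simp only [Wf, clip]
    fun_prop
  have hgU : ∀ q a, Continuous fun v => g q a (U v) (Wf v) := fun q a =>
    (hg q a).comp (hU.prodMk hW)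
  have hTU : ∀ r, Continuous fun v => T r (U v) (Wf v) := fun r => (hT r).comp (hU.prodMk hW)
  have hUq : ∀ q a, Continuous fun v => U v q a := fun q a =>
    (continuous_apply a).comp ((continuous_apply q).comp hU)
  let gain : ((Σ q, F q) ⊕ R → ℝ) → ∀ q, F q → ℝ := fun v q a =>
    max (∑ b, U v q b * g q b (U v) (Wf v) - g q a (U v) (Wf v)) 0
  have hgain : ∀ q a, Continuous fun v => gain v q a := by
    intro q a
    simp only [gain]
    refine Continuous.max ?_ continuous_const
    refine Continuous.sub ?_ (hgU q a)
    exact continuous_finsetSum _ fun b _ => (hUq q b).mul (hgU q b)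
  have hgain0 : ∀ v q a, 0 ≤ gain v q a := fun v q a => le_max_right _ _
  let f : ((Σ q, F q) ⊕ R → ℝ) → ((Σ q, F q) ⊕ R → ℝ) := fun v =>
    Sum.elim (fun qa => (U v qa.1 qa.2 + gain v qa.1 qa.2) / (1 + ∑ c, gain v qa.1 c))
      (fun r => clip (T r (U v) (Wf v)))
  have hden : ∀ v q, 0 < 1 + ∑ c, gain v q c := fun v q => by
    have := Finset.sum_nonneg fun c (_ : c ∈ Finset.univ) => hgain0 v q c
    linarith
  have hf : Continuous f := by
    refine continuous_pi fun z => ?_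
    rcases z with ⟨q, a⟩ | r
    · simp only [f, Sum.elim_inl]
      refine Continuous.div ((hUq q a).add (hgain q a)) ?_ (fun v => (hden v q).ne')
      exact continuous_const.add (continuous_finsetSum _ fun c _ => hgain q c)
    · simp only [f, Sum.elim_inr, clip]
      exact continuous_const.max ((hTU r).min continuous_const)
  have hU0 : ∀ v q a, 0 ≤ U v q a := fun v q a => sretr_nonneg _ _
  have hU1 : ∀ v q, ∑ a, U v q a = 1 := fun v q => sretr_sum _
  have hnum : ∀ v q a, 0 ≤ f v (Sum.inl ⟨q, a⟩) := fun v q a => by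
    simp only [f, Sum.elim_inl]
    exact div_nonneg (add_nonneg (hU0 _ _ _) (hgain0 _ _ _)) (hden v q).le
  have hsum : ∀ v q, ∑ a, f v (Sum.inl ⟨q, a⟩) = 1 := fun v q => by
    calc ∑ a, f v (Sum.inl ⟨q, a⟩) = (∑ a, (U v q a + gain v q a)) / (1 + ∑ c, gain v q c) :=
          (Finset.sum_div Finset.univ (fun a => U v q a + gain v q a) (1 + ∑ c, gain v q c)).symm
      _ = 1 := by
          rw [Finset.sum_add_distrib, hU1]
          exact div_self (hden v q).ne'
  obtain ⟨v, hv⟩ := BrouwerAux.brouwer f (max 1 C) hf (by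
    intro v z
    rcases z with ⟨q, a⟩ | r
    · refine le_trans ?_ (le_max_left _ _)
      rw [abs_of_nonneg (hnum v q a), ← hsum v q]
      exact Finset.single_le_sum (f := fun a => f v (Sum.inl ⟨q, a⟩))
        (fun a _ => hnum v q a) (Finset.mem_univ a)
    · exact (hclip _).trans (le_max_right _ _))
  have hUv : ∀ q a, U v q a = v (Sum.inl ⟨q, a⟩) := by
    intro q a
    have := sretr_eq (fun a => v (Sum.inl ⟨q, a⟩)) (fun a => by rw [← hv]; exact hnum v q a)
      (by rw [← hsum v q]; simp_rw [hv])
    exact congrFun this a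
  have hWb : ∀ r, |Wf v r| ≤ C := fun r => hclip _
  refine ⟨U v, Wf v, hU0 v, hU1 v, hWb, ?_, ?_⟩
  · intro r
    have h1 : v (Sum.inr r) = clip (T r (U v) (Wf v)) := by
      conv_lhs => rw [← hv]
      simp [f]
    have h2 := hbd (U v) (Wf v) (hU0 v) (hU1 v) hWb r
    rw [hclip2 _ h2] at h1
    rw [← h1]
    exact hclip2 _ (h1 ▸ h2)
  · intro q a
    refine nash_gain (U v q) (fun a => g q a (U v) (Wf v)) (hU0 v q) (hU1 v q) ?_ a
    intro a
    conv_lhs => rw [hUv, ← hv]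
    rfl

end NashAux


open MeasureTheory ProbabilityTheory Filter Topology
open scoped ENNReal NNReal

namespace CSGame

section PiLemmas

variable {n : ℕ} {A : Fin n → Type} [∀ i, MeasurableSpace (A i)]

instance update_prob (ν : ∀ j, Measure (A j)) [∀ j, IsProbabilityMeasure (ν j)]
    (i : Fin n) (μ : Measure (A i)) [IsProbabilityMeasure μ] (j : Fin n) :
    IsProbabilityMeasure (Function.update ν i μ j) := by
  rcases eq_or_ne j i with rfl | h
  · simpa using ‹IsProbabilityMeasure μ›
  · rw [Function.update_of_ne h]; infer_instance

lemma measurable_upd (i : Fin n) :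
    Measurable fun q : A i × (∀ j, A j) => Function.update q.2 i q.1 := by
  refine measurable_pi_lambda _ fun j => ?_
  rcases eq_or_ne j i with rfl | h
  · simpa using measurable_fst
  · simp only [Function.update_of_ne h]
    exact (measurable_pi_apply j).comp measurable_snd

lemma pi_update (ν : ∀ j, Measure (A j)) [∀ j, IsProbabilityMeasure (ν j)]
    (i : Fin n) (μ : Measure (A i)) [IsProbabilityMeasure μ] :
    Measure.pi (Function.update ν i μ) =
      (μ.prod (Measure.pi ν)).map (fun q => Function.update q.2 i q.1) := by
  refine Measure.pi_eq fun s hs => ?_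
  rw [Measure.map_apply (measurable_upd i) (MeasurableSet.univ_pi hs)]
  have : (fun q : A i × (∀ j, A j) => Function.update q.2 i q.1) ⁻¹' (Set.univ.pi s) =
      s i ×ˢ Set.univ.pi (Function.update s i Set.univ) := by
    ext q
    simp only [Set.mem_preimage, Set.mem_pi, Set.mem_univ, true_implies, Set.mem_prod]
    constructor
    · intro h
      refine ⟨by simpa using h i, fun j => ?_⟩
      rcases eq_or_ne j i with rfl | hj
      · simp
      · simpa [Function.update_of_ne hj] using h j
    · rintro ⟨h1, h2⟩ j
      rcases eq_or_ne j i with rfl | hj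
      · simpa using h1
      · simpa [Function.update_of_ne hj] using h2 j
  rw [this, Measure.prod_prod, Measure.pi_pi]
  rw [← Finset.mul_prod_erase Finset.univ (fun j => (Function.update ν i μ j) (s j)) (Finset.mem_univ i)]
  rw [← Finset.mul_prod_erase Finset.univ (fun j => (ν j) (Function.update s i Set.univ j)) (Finset.mem_univ i)]
  simp only [Function.update_self, measure_univ, one_mul]
  congr 1
  refine Finset.prod_congr rfl fun j hj => ?_
  have hj := Finset.ne_of_mem_erase hj
  rw [Function.update_of_ne hj, Function.update_of_ne hj]

lemma lintegral_pi_update (ν : ∀ j, Measure (A j)) [∀ j, IsProbabilityMeasure (ν j)]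
    (i : Fin n) (μ : Measure (A i)) [IsProbabilityMeasure μ] (f : (∀ j, A j) → ℝ≥0∞)
    (hf : Measurable f) :
    ∫⁻ b, f b ∂(Measure.pi (Function.update ν i μ)) =
      ∫⁻ a, ∫⁻ b, f (Function.update b i a) ∂(Measure.pi ν) ∂μ := by
  rw [pi_update, lintegral_map hf (measurable_upd i), lintegral_prod]
  exact (hf.comp (measurable_upd i)).aemeasurable

lemma integral_pi_update (ν : ∀ j, Measure (A j)) [∀ j, IsProbabilityMeasure (ν j)]
    (i : Fin n) (μ : Measure (A i)) [IsProbabilityMeasure μ] (f : (∀ j, A j) → ℝ)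
    (hf : Measurable f) (hfi : Integrable f (Measure.pi (Function.update ν i μ))) :
    Integrable (fun a => ∫ b, f (Function.update b i a) ∂(Measure.pi ν)) μ ∧
    ∫ b, f b ∂(Measure.pi (Function.update ν i μ)) =
      ∫ a, ∫ b, f (Function.update b i a) ∂(Measure.pi ν) ∂μ := by
  rw [pi_update] at hfi ⊢
  have h2 : Integrable (fun q : A i × (∀ j, A j) => f (Function.update q.2 i q.1))
      (μ.prod (Measure.pi ν)) := by
    exact (integrable_map_measure hf.aestronglyMeasurable (measurable_upd i).aemeasurable).1 hfi
  refine ⟨h2.integral_prod_left, ?_⟩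
  rw [integral_map (measurable_upd i).aemeasurable hf.aestronglyMeasurable, integral_prod _ h2]

/-- finitely supported measure -/
noncomputable def fsm {Ω : Type*} [MeasurableSpace Ω] {F : Finset Ω} (u : F → ℝ) : Measure Ω :=
  ∑ a : F, ENNReal.ofReal (u a) • Measure.dirac (a : Ω)

lemma fsm_apply {Ω : Type*} [MeasurableSpace Ω] {F : Finset Ω} (u : F → ℝ) (s : Set Ω)
    (hs : MeasurableSet s) :
    fsm u s = ∑ a : F, ENNReal.ofReal (u a) * s.indicator 1 (a : Ω) := by
  simp [fsm, Measure.dirac_apply', hs]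

lemma fsm_prob {Ω : Type*} [MeasurableSpace Ω] {F : Finset Ω} (u : F → ℝ)
    (h0 : ∀ a, 0 ≤ u a) (h1 : ∑ a, u a = 1) : IsProbabilityMeasure (fsm u) := by
  constructor
  rw [fsm_apply _ _ MeasurableSet.univ]
  simp only [Set.indicator_univ, Pi.one_apply, mul_one]
  rw [← ENNReal.ofReal_sum_of_nonneg (fun a _ => h0 a), h1, ENNReal.ofReal_one]

lemma integral_fsm {Ω : Type*} [MeasurableSpace Ω] [MeasurableSingletonClass Ω] {F : Finset Ω}
    (u : F → ℝ) (h0 : ∀ a, 0 ≤ u a) (f : Ω → ℝ) : ∫ x, f x ∂(fsm u) = ∑ a : F, u a * f a := by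
  unfold fsm
  rw [integral_finsetSum_measure]
  · refine Finset.sum_congr rfl fun a _ => ?_
    rw [integral_smul_measure, integral_dirac, ENNReal.toReal_ofReal (h0 a), smul_eq_mul]
  · intro a _
    exact (integrable_dirac (by simp [enorm])).smul_measure ENNReal.ofReal_ne_top

lemma pi_fsm {F : ∀ i, Finset (A i)} (u : ∀ i, F i → ℝ)
    (h0 : ∀ i a, 0 ≤ u i a) (h1 : ∀ i, ∑ a, u i a = 1) :
    Measure.pi (fun i => fsm (u i)) =
      ∑ b : (∀ i, F i), ENNReal.ofReal (∏ i, u i (b i)) • Measure.dirac (fun i => (b i : A i)) := by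
  have := fun i => fsm_prob (u i) (h0 i) (h1 i)
  refine Measure.pi_eq fun s hs => ?_
  simp only [fsm_apply _ _ (hs _)]
  rw [Finset.prod_univ_sum]
  simp only [Measure.coe_finsetSum, Finset.sum_apply, Measure.smul_apply, smul_eq_mul,
    Measure.dirac_apply' _ (MeasurableSet.univ_pi hs), Fintype.piFinset_univ]
  refine Finset.sum_congr rfl fun b _ => ?_
  rw [Finset.prod_mul_distrib, ENNReal.ofReal_prod_of_nonneg (fun i _ => h0 i _)]
  congr 1
  by_cases h : ∀ i, (b i : A i) ∈ s i
  · rw [Set.indicator_of_mem (by simpa using h)]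
    symm
    exact Finset.prod_eq_one fun i _ => by rw [Set.indicator_of_mem (h i)]; rfl
  · rw [Set.indicator_of_notMem (by simpa using h)]
    push Not at h
    obtain ⟨i, hi⟩ := h
    symm
    exact Finset.prod_eq_zero (Finset.mem_univ i) (by rw [Set.indicator_of_notMem hi])

lemma integral_pi_fsm [∀ i, MeasurableSingletonClass (A i)] {F : ∀ i, Finset (A i)}
    (u : ∀ i, F i → ℝ)
    (h0 : ∀ i a, 0 ≤ u i a) (h1 : ∀ i, ∑ a, u i a = 1) (f : (∀ i, A i) → ℝ) :
    Integrable f (Measure.pi (fun i => fsm (u i))) ∧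
    ∫ x, f x ∂(Measure.pi (fun i => fsm (u i))) =
      ∑ b : (∀ i, F i), (∏ i, u i (b i)) * f (fun i => (b i : A i)) := by
  rw [pi_fsm u h0 h1]
  have hi : ∀ b ∈ (Finset.univ : Finset (∀ i, F i)), Integrable f (ENNReal.ofReal (∏ i, u i (b i)) •
      Measure.dirac (fun i => (b i : A i))) := fun b _ =>
    (integrable_dirac (by simp [enorm])).smul_measure ENNReal.ofReal_ne_top
  refine ⟨integrable_finsetSum_measure.2 hi, ?_⟩
  rw [integral_finsetSum_measure hi]
  refine Finset.sum_congr rfl fun b _ => ?_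
  rw [integral_smul_measure, integral_dirac,
    ENNReal.toReal_ofReal (Finset.prod_nonneg fun i _ => h0 i _), smul_eq_mul]

end PiLemmas

end CSGame

open MeasureTheory ProbabilityTheory Filter Topology
open scoped ENNReal NNReal

namespace CSGame

set_option linter.unusedSectionVars false
set_option linter.style.haveILetI false
set_option linter.unusedSimpArgs false

variable {n l : ℕ}
variable {X : Type} [Countable X] [MeasurableSpace X] [DiscreteMeasurableSpace X]
  [TopologicalSpace X] [DiscreteTopology X] [BorelSpace X] [SecondCountableTopology X]
variable {A : Fin n → Type} [∀ i, MeasurableSpace (A i)] [∀ i, TopologicalSpace (A i)]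
  [∀ i, PolishSpace (A i)] [∀ i, BorelSpace (A i)]
variable (G : GameData n l X A)

/-- The law of the action of player `i` in state `x`. -/
noncomputable def sl {i : Fin n} (φ : Stat G i) (x : X) : Measure (A i) := (φ.1 x : Measure (A i))

instance {i : Fin n} (φ : Stat G i) (x : X) : IsProbabilityMeasure (sl G φ x) := by
  unfold sl; infer_instance

/-- Law of the joint action in state `x` under a stationary profile. -/
noncomputable def sj (φ : StatProfile G) (x : X) : Measure (JA A) :=
  Measure.pi fun j => sl G (φ j) x

lemma exists_stat (i : Fin n) (ν : X → Measure (A i)) (h1 : ∀ x, IsProbabilityMeasure (ν x))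
    (h2 : ∀ x, ν x (G.As i x) = 1) : ∃ φ : Stat G i, ∀ x, sl G φ x = ν x := by
  let ψ : X → ProbabilityMeasure (A i) := fun x => ⟨ν x, h1 x⟩
  have hψ : ∀ x, ψ x (G.As i x) = 1 := by
    intro x
    rw [← ENNReal.coe_inj, ProbabilityMeasure.ennreal_coeFn_eq_coeFn_toMeasure]
    exact h2 x
  exact ⟨⟨ψ, hψ⟩, fun x => rfl⟩

instance (φ : StatProfile G) (x : X) : IsProbabilityMeasure (sj G φ x) := by
  unfold sj; infer_instance

lemma measurableSet_As (i : Fin n) (x : X) : MeasurableSet (G.As i x) :=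
  (G.hAs_cpt i x).isClosed.measurableSet

lemma measurableSet_jointSet (x : X) : MeasurableSet (jointSet G x) :=
  MeasurableSet.univ_pi fun i => measurableSet_As G i x

lemma isCompact_jointSet (x : X) : IsCompact (jointSet G x) :=
  isCompact_univ_pi fun i => G.hAs_cpt i x

lemma ae_pi_mem (x : X) (ν : ∀ j, Measure (A j)) [∀ j, IsProbabilityMeasure (ν j)]
    (h : ∀ j, ν j (G.As j x) = 1) : ∀ᵐ b ∂(Measure.pi ν), b ∈ jointSet G x := by
  have : Measure.pi ν (jointSet G x) = 1 := by
    rw [jointSet, Measure.pi_pi]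
    exact Finset.prod_eq_one fun i _ => h i
  exact (mem_ae_iff_prob_eq_one (measurableSet_jointSet G x)).2 this

lemma stat_supp (i : Fin n) (φ : Stat G i) (x : X) : sl G φ x (G.As i x) = 1 := by
  have := φ.2 x
  unfold sl
  rw [← ProbabilityMeasure.ennreal_coeFn_eq_coeFn_toMeasure, this]; rfl

lemma sj_ae (φ : StatProfile G) (x : X) : ∀ᵐ b ∂(sj G φ x), b ∈ jointSet G x :=
  ae_pi_mem G x _ fun j => stat_supp G j (φ j) x

lemma update_mem {i : Fin n} {x : X} {b : JA A} (hb : b ∈ jointSet G x) {a : A i}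
    (ha : a ∈ G.As i x) : Function.update b i a ∈ jointSet G x := by
  intro j _
  rcases eq_or_ne j i with rfl | h
  · simpa using ha
  · simpa [Function.update_of_ne h] using hb j trivial

lemma exists_net {R : Type} [Fintype R] (i : Fin n) (x : X) (h : JA A → (R → ℝ) → ℝ)
    (hh : ContinuousOn (fun z : JA A × (R → ℝ) => h z.1 z.2) (jointSet G x ×ˢ Set.univ))
    (C : ℝ) (ε : ℝ) (hε : 0 < ε) :
    ∃ F : Finset (A i), F.Nonempty ∧ (∀ a ∈ F, a ∈ G.As i x) ∧
      ∀ a ∈ G.As i x, ∃ a' ∈ F, ∀ b ∈ jointSet G x, ∀ W : R → ℝ, (∀ r, |W r| ≤ C) →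
        h (Function.update b i a') W ≤ h (Function.update b i a) W + ε := by
  letI : ∀ j, MetricSpace (A j) := fun j => TopologicalSpace.metrizableSpaceMetric (A j)
  let B : Set (R → ℝ) := Set.univ.pi fun _ => Set.Icc (-C) C
  have hB : IsCompact B := isCompact_univ_pi fun _ => isCompact_Icc
  have hK : IsCompact (jointSet G x ×ˢ B) := (isCompact_jointSet G x).prod hB
  have hu := hK.uniformContinuousOn_of_continuous (hh.mono (Set.prod_mono le_rfl (Set.subset_univ _)))
  obtain ⟨δ, hδ, hu⟩ := Metric.uniformContinuousOn_iff.1 hu ε hε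
  obtain ⟨t, hts, htf, htc⟩ := (G.hAs_cpt i x).finite_cover_balls hδ
  refine ⟨htf.toFinset, ?_, ?_, ?_⟩
  · obtain ⟨a, ha⟩ := G.hAs_ne i x
    have := htc ha
    simp only [Set.mem_iUnion] at this
    obtain ⟨y, hy, _⟩ := this
    exact ⟨y, by simpa using hy⟩
  · intro a ha
    exact hts (by simpa using ha)
  · intro a ha
    have := htc ha
    simp only [Set.mem_iUnion] at this
    obtain ⟨y, hy, hay⟩ := this
    refine ⟨y, by simpa using hy, ?_⟩
    intro b hb W hW
    have hWB : W ∈ B := fun r _ => abs_le.1 (hW r)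
    have := hu (Function.update b i y, W) ⟨update_mem G hb (hts hy), hWB⟩
      (Function.update b i a, W) ⟨update_mem G hb ha, hWB⟩ (by
        rw [Prod.dist_eq, max_lt_iff]
        refine ⟨?_, by simpa using hδ⟩
        rw [dist_pi_lt_iff hδ]
        intro j
        rcases eq_or_ne j i with rfl | hj
        · simp only [Function.update_self]
          rw [dist_comm]; exact hay
        · simpa [Function.update_of_ne hj] using hδ)
    rw [Real.dist_eq] at this
    have := (abs_lt.1 this).2
    simp only at this
    linarith

theorem approx_eq (S : Finset X) {R : Type} [Fintype R] (xs : R → S)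
    (t : R → JA A → (R → ℝ) → ℝ) (h : Fin n → S → JA A → (R → ℝ) → ℝ) (C : ℝ) (hC : 0 ≤ C)
    (ht : ∀ r b, Continuous (t r b))
    (hhm : ∀ i x W, Measurable fun b => h i x b W)
    (hh : ∀ i x, ContinuousOn (fun z : JA A × (R → ℝ) => h i x z.1 z.2)
      (jointSet G x ×ˢ Set.univ))
    (hbd : ∀ r b, b ∈ jointSet G (xs r) → ∀ W : R → ℝ, (∀ r, |W r| ≤ C) → |t r b W| ≤ C)
    (ε : ℝ) (hε : 0 < ε) :
    ∃ (φ : StatProfile G) (W : R → ℝ), (∀ r, |W r| ≤ C) ∧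
      (∀ r, W r = ∫ b, t r b W ∂(sj G φ (xs r))) ∧
      ∀ i (x : S), ∀ a ∈ G.As i x, ∫ b, h i x b W ∂(sj G φ x) ≤
        ∫ b, h i x (Function.update b i a) W ∂(sj G φ x) + ε := by
  classical
  choose F hF1 hF2 hF3 using fun (q : Fin n × S) =>
    exists_net G q.1 q.2 (h q.1 q.2) (hh q.1 q.2) C ε hε
  haveI : ∀ q, Nonempty (F q) := fun q => (hF1 q).to_subtype
  -- expectation of a function of the joint action in state `x`
  let E : S → (∀ q, F q → ℝ) → (JA A → ℝ) → ℝ := fun x u f =>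
    ∑ b : (∀ i, F (i, x)), (∏ i, u (i, x) (b i)) * f (fun i => (b i : A i))
  have hcontW : ∀ i (x : S) (b : JA A), b ∈ jointSet G x → Continuous fun W => h i x b W := by
    intro i x b hb
    rw [← continuousOn_univ]
    exact (hh i x).comp (f := fun W => (b, W)) (by fun_prop) (fun W _ => ⟨hb, trivial⟩)
  have hmem : ∀ (x : S) (b : ∀ i, F (i, x)), (fun i => (b i : A i)) ∈ jointSet G x :=
    fun x b i _ => hF2 (i, x) _ (b i).2
  obtain ⟨u, W, hu0, hu1, hW, hT, hN⟩ := NashAux.nash_abstract (F := fun q => F q)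
    (fun q a u W => E q.2 u fun b => h q.1 q.2 (Function.update b q.1 a) W)
    (by
      intro q a
      simp only [E]
      refine continuous_finsetSum _ fun b _ => Continuous.mul (by fun_prop) ?_
      exact (hcontW q.1 q.2 _ (update_mem G (hmem q.2 b) (hF2 q _ a.2))).comp continuous_snd)
    (fun r u W => E (xs r) u fun b => t r b W)
    (by
      intro r
      simp only [E]
      refine continuous_finsetSum _ fun b _ => Continuous.mul (by fun_prop) ?_
      exact (ht r _).comp continuous_snd)
    C hC (by
      intro u W h0 h1 hW r
      simp only [E]
      refine (Finset.abs_sum_le_sum_abs _ _).trans ?_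
      calc _ ≤ ∑ b : (∀ i, F (i, xs r)), (∏ i, u (i, xs r) (b i)) * C := by
            refine Finset.sum_le_sum fun b _ => ?_
            rw [abs_mul, abs_of_nonneg (Finset.prod_nonneg fun i _ => h0 _ _)]
            exact mul_le_mul_of_nonneg_left (hbd r _ (hmem _ b) W hW)
              (Finset.prod_nonneg fun i _ => h0 _ _)
        _ = C := by
            rw [← Finset.sum_mul]
            have := Finset.prod_univ_sum (fun i : Fin n => (Finset.univ : Finset (F (i, xs r))))
              (fun i a => u (i, xs r) a)
            rw [Fintype.piFinset_univ, Finset.prod_eq_one (fun i _ => h1 (i, xs r))] at this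
            rw [← this, one_mul])
  have hsupp : ∀ q : Fin n × S, fsm (u q) (G.As q.1 q.2) = 1 := by
    intro q
    rw [fsm_apply _ _ (measurableSet_As G _ _)]
    have := (fsm_prob (u q) (hu0 q) (hu1 q)).measure_univ
    rw [fsm_apply _ _ MeasurableSet.univ] at this
    rw [← this]
    refine Finset.sum_congr rfl fun a _ => ?_
    rw [Set.indicator_of_mem (hF2 q _ a.2), Set.indicator_of_mem (Set.mem_univ _)]
  have hex : ∀ i : Fin n, ∃ φ : Stat G i, ∀ x (hx : x ∈ S), sl G φ x = fsm (u (i, ⟨x, hx⟩)) := by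
    intro i
    obtain ⟨φ, hφ⟩ := exists_stat G i (fun x => if hx : x ∈ S then fsm (u (i, ⟨x, hx⟩)) else
        Measure.dirac (G.hAs_ne i x).some) (by
        intro x
        by_cases hx : x ∈ S
        · simp only [hx, dite_true]
          exact fsm_prob _ (hu0 (i, ⟨x, hx⟩)) (hu1 (i, ⟨x, hx⟩))
        · simp only [hx, dite_false]
          infer_instance) (by
        intro x
        by_cases hx : x ∈ S
        · simp only [hx, dite_true]
          exact hsupp (i, ⟨x, hx⟩)
        · simp only [hx, dite_false]
          exact Measure.dirac_apply_of_mem (G.hAs_ne i x).some_mem)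
    refine ⟨φ, fun x hx => ?_⟩
    rw [hφ]
    simp [hx]
  choose φ hφ' using hex
  have hφ : ∀ (i : Fin n) (x : S), sl G (φ i) x = fsm (u (i, x)) := fun i x => hφ' i x x.2
  have hsj : ∀ x : S, sj G φ x = Measure.pi (fun i => fsm (u (i, x))) := by
    intro x
    unfold sj
    congr 1
    funext i
    exact hφ i x
  have hE : ∀ (x : S) (f : JA A → ℝ), Integrable f (sj G φ x) ∧
      ∫ b, f b ∂(sj G φ x) = E x u f := by
    intro x f
    rw [hsj]
    exact integral_pi_fsm (fun i => u (i, x)) (fun i => hu0 _) (fun i => hu1 _) f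
  refine ⟨φ, W, hW, fun r => ?_, fun i x a ha => ?_⟩
  · rw [hT r, (hE (xs r) _).2]
  · obtain ⟨a', ha', haa⟩ := hF3 (i, x) a ha
    have h1 := hN (i, x) ⟨a', ha'⟩
    have h2 : ∫ b, h i x b W ∂(sj G φ x) = ∑ b, u (i, x) b * E x u fun c =>
        h i x (Function.update c i b) W := by
      have h3 := integral_pi_update (fun j => sl G (φ j) (x : X)) i
        (sl G (φ i) (x : X)) (fun b => h i x b W) (hhm i x W) (by
          rw [Function.update_eq_self i (fun j => sl G (φ j) (x : X))]
          exact (hE x _).1)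
      rw [Function.update_eq_self i (fun j => sl G (φ j) (x : X))] at h3
      refine h3.2.trans ?_
      rw [hφ, integral_fsm _ (hu0 _)]
      refine Finset.sum_congr rfl fun b _ => ?_
      exact congrArg (fun z => u (i, x) b * z) (hE x _).2
    rw [h2]
    refine h1.trans ?_
    refine (hE x (fun b => h i x (Function.update b i a') W)).2.symm.le.trans ?_
    calc _ ≤ ∫ b, (h i x (Function.update b i a) W + ε) ∂(sj G φ x) := by
          refine integral_mono_ae (hE x _).1 (hE x _).1 ?_
          filter_upwards [sj_ae G φ x] with b hb
          exact haa b hb W hW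
      _ = _ := by
          rw [integral_add (hE x _).1 (hE x _).1]; simp

end CSGame

open MeasureTheory ProbabilityTheory Filter Topology
open scoped ENNReal NNReal

namespace CSGame

set_option linter.unusedSectionVars false
set_option linter.style.haveILetI false
set_option linter.unusedSimpArgs false

variable {n l : ℕ}
variable {X : Type} [Countable X] [MeasurableSpace X] [DiscreteMeasurableSpace X]
  [TopologicalSpace X] [DiscreteTopology X] [BorelSpace X] [SecondCountableTopology X]
variable {A : Fin n → Type} [∀ i, MeasurableSpace (A i)] [∀ i, TopologicalSpace (A i)]
  [∀ i, PolishSpace (A i)] [∀ i, BorelSpace (A i)]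
variable (G : GameData n l X A)

section General

variable (π : MultiStrategy G)

instance jointLaw_prob (t : ℕ) (h : Hist X (JA A) t) : IsProbabilityMeasure (jointLaw G π t h) := by
  unfold jointLaw; infer_instance

lemma strat_supp (i : Fin n) (σ : Strategy G i) (t : ℕ) (h : Hist X (JA A) t) :
    (σ.f t h : Measure (A i)) (G.As i (lastState X (JA A) t h)) = 1 := by
  have := σ.supp t h
  rw [← ProbabilityMeasure.ennreal_coeFn_eq_coeFn_toMeasure, this]; rfl

lemma measurable_jointLaw (t : ℕ) : Measurable (jointLaw G π t) := by
  refine Measurable.measure_of_isPiSystem_of_isProbabilityMeasure generateFrom_pi.symm isPiSystem_pi ?_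
  rintro s ⟨s', hs', rfl⟩
  simp only [jointLaw, Measure.pi_pi]
  refine Finset.measurable_prod _ fun i _ => (π i).meas t _ (hs' i trivial)

lemma measurable_pk {Ω : Type*} [MeasurableSpace Ω] (f : Ω → X) (g : Ω → JA A) (hf : Measurable f)
    (hg : Measurable g) : Measurable fun q => G.p (f q) (g q) := by
  refine Measure.measurable_of_measurable_coe _ fun s hs => ?_
  have h1 : Measurable fun z : X × JA A => G.p z.1 z.2 s := by
    refine measurable_from_prod_countable_right fun x => ?_
    have : ∀ a, G.p x a s = ∑' y : s, G.p x a {(y : X)} := by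
      intro a
      conv_lhs => rw [← Set.biUnion_of_singleton s]
      rw [measure_biUnion s.to_countable]
      · intro y _ z _ hyz
        simpa using hyz
      · intro y _; exact MeasurableSet.of_discrete
    simp_rw [this]
    exact Measurable.tsum fun y => G.hpm x y
  exact h1.comp (hf.prodMk hg)

lemma lintegral_hist_succ (η' : Measure X) (t : ℕ) (f : Hist X (JA A) t × JA A × X → ℝ≥0∞)
    (hf : Measurable f) :
    ∫⁻ z, f z ∂(show Measure (Hist X (JA A) t × JA A × X) from histMeas G η' π (t + 1)) =
      ∫⁻ h, ∫⁻ a, ∫⁻ y, f (h, a, y) ∂(G.p (lastState X (JA A) t h) a) ∂(jointLaw G π t h)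
        ∂(histMeas G η' π t) := by
  have hN : Measurable fun q : Hist X (JA A) t × JA A =>
      (G.p (lastState X (JA A) t q.1) q.2).map (fun y => (q.1, q.2, y)) := by
    have hk := measurable_pk G (fun q : Hist X (JA A) t × JA A => lastState X (JA A) t q.1)
      (fun q => q.2) ((measurable_lastState X (JA A) t).comp measurable_fst) measurable_snd
    refine Measure.measurable_of_measurable_coe _ fun s hs => ?_
    let κ : Kernel (Hist X (JA A) t × JA A) X := ⟨_, hk⟩
    have : IsMarkovKernel κ := ⟨fun q => G.hp _ _⟩
    have h1 : ∀ q : Hist X (JA A) t × JA A,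
        ((G.p (lastState X (JA A) t q.1) q.2).map (fun y => (q.1, q.2, y))) s =
          κ q (Prod.mk q ⁻¹' (MeasurableEquiv.prodAssoc ⁻¹' s)) := by
      intro q
      rw [Measure.map_apply (by fun_prop) hs]
      rfl
    simp_rw [h1]
    exact Kernel.measurable_kernel_prodMk_left (MeasurableEquiv.prodAssoc.measurable hs)
  have hB : Measurable fun h : Hist X (JA A) t => (jointLaw G π t h).bind fun a =>
      (G.p (lastState X (JA A) t h) a).map (fun y => (h, a, y)) := by
    refine Measure.measurable_of_measurable_coe _ fun s hs => ?_
    let κ : Kernel (Hist X (JA A) t) (JA A) := ⟨_, measurable_jointLaw G π t⟩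
    have : IsMarkovKernel κ := ⟨fun q => jointLaw_prob G π t q⟩
    have h1 : ∀ h : Hist X (JA A) t, ((jointLaw G π t h).bind fun a =>
        (G.p (lastState X (JA A) t h) a).map (fun y => (h, a, y))) s =
        ∫⁻ a, ((G.p (lastState X (JA A) t h) a).map (fun y => (h, a, y))) s ∂(κ h) := by
      intro h
      exact Measure.bind_apply hs (hN.comp measurable_prodMk_left).aemeasurable
    simp_rw [h1]
    exact Measurable.lintegral_kernel_prod_right'
      (f := fun q : Hist X (JA A) t × JA A =>
        ((G.p (lastState X (JA A) t q.1) q.2).map (fun y => (q.1, q.2, y))) s)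
      (Measure.measurable_measure.1 hN s hs)
  have e1 := Measure.lintegral_bind (m := histMeas G η' π t) hB.aemeasurable hf.aemeasurable
  refine e1.trans ?_
  refine lintegral_congr fun h => ?_
  have e2 := Measure.lintegral_bind (m := jointLaw G π t h)
    (hN.comp (measurable_prodMk_left (x := h))).aemeasurable hf.aemeasurable
  refine e2.trans ?_
  refine lintegral_congr fun a => ?_
  exact lintegral_map hf (by fun_prop)

instance histMeas_prob (t : ℕ) : IsProbabilityMeasure (histMeas G G.η π t) := by
  induction t with
  | zero => exact G.hη
  | succ t ih =>
    constructor
    have := lintegral_hist_succ G π G.η t (fun _ => 1) measurable_const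
    have hp := G.hp
    simp only [lintegral_const, measure_univ, mul_one] at this
    exact (lintegral_one (μ := histMeas G G.η π (t + 1))).symm.trans this

/-- The law of the state at stage `t`. -/
noncomputable def slw (t : ℕ) : Measure X := (histMeas G G.η π t).map (lastState X (JA A) t)

instance slw_prob (t : ℕ) : IsProbabilityMeasure (slw G π t) :=
  Measure.isProbabilityMeasure_map (measurable_lastState X (JA A) t).aemeasurable

lemma slw_zero : slw G π 0 = G.η := Measure.map_id

lemma slw_succ (t : ℕ) (y : X) : slw G π (t + 1) {y} =
    ∫⁻ h, ∫⁻ a, G.p (lastState X (JA A) t h) a {y} ∂(jointLaw G π t h) ∂(histMeas G G.η π t) := by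
  have h1 := lintegral_hist_succ G π G.η t (fun z => Set.indicator {y} 1 z.2.2)
    ((measurable_one.indicator (measurableSet_singleton y)).comp
      (measurable_snd.comp measurable_snd))
  have h2 : slw G π (t + 1) {y} = ∫⁻ x, Set.indicator {y} 1 x ∂(slw G π (t + 1)) := by
    rw [lintegral_indicator_one (measurableSet_singleton y)]
  rw [h2, slw, lintegral_map (measurable_one.indicator (measurableSet_singleton y))
    (measurable_lastState X (JA A) (t + 1))]
  refine h1.trans ?_
  refine lintegral_congr fun h => lintegral_congr fun a => ?_
  exact lintegral_indicator_one (measurableSet_singleton y)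

lemma wStateExp_eq (t : ℕ) (w : X → ℝ) :
    wStateExp G G.η π t w = ∫⁻ x, ENNReal.ofReal (w x) ∂(slw G π t) := by
  rw [slw, lintegral_map Measurable.of_discrete (measurable_lastState X (JA A) t)]
  rfl

end General

end CSGame

open MeasureTheory ProbabilityTheory Filter Topology
open scoped ENNReal NNReal

namespace CSGame

set_option linter.unusedSectionVars false
set_option linter.style.haveILetI false
set_option linter.unusedSimpArgs false

variable {n l : ℕ}
variable {X : Type} [Countable X] [MeasurableSpace X] [DiscreteMeasurableSpace X]
  [TopologicalSpace X] [DiscreteTopology X] [BorelSpace X] [SecondCountableTopology X]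
variable {A : Fin n → Type} [∀ i, MeasurableSpace (A i)] [∀ i, TopologicalSpace (A i)]
  [∀ i, PolishSpace (A i)] [∀ i, BorelSpace (A i)]
variable (G : GameData n l X A)

/-- The multi-strategy induced by a Markov profile. -/
noncomputable def ofMarkov (τ : ℕ → StatProfile G) : MultiStrategy G := fun i =>
  { f := fun t h => (τ t i).1 (lastState X (JA A) t h)
    meas := fun t _s _hs =>
      (Measurable.of_discrete (f := fun x => ((τ t i).1 x : Measure (A i)) _s)).comp
        (measurable_lastState X (JA A) t)
    supp := fun t _ => (τ t i).2 _ }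

lemma ofStatAll_eq (φ : StatProfile G) : ofStatAll G φ = ofMarkov G fun _ => φ := rfl

lemma jointLaw_ofMarkov (τ : ℕ → StatProfile G) (t : ℕ) (h : Hist X (JA A) t) :
    jointLaw G (ofMarkov G τ) t h = sj G (τ t) (lastState X (JA A) t h) := rfl

lemma slw_succ_markov (τ : ℕ → StatProfile G) (t : ℕ) (y : X) :
    slw G (ofMarkov G τ) (t + 1) {y} =
      ∫⁻ x, ∫⁻ a, G.p x a {y} ∂(sj G (τ t) x) ∂(slw G (ofMarkov G τ) t) := by
  rw [slw_succ]
  simp only [jointLaw_ofMarkov]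
  rw [slw, lintegral_map (f := fun x => ∫⁻ a, G.p x a {y} ∂(sj G (τ t) x)) Measurable.of_discrete
    (measurable_lastState X (JA A) t)]

lemma stageExp_markov (τ : ℕ → StatProfile G) (t : ℕ) (f : X → JA A → ℝ) :
    stageExp G G.η (ofMarkov G τ) t f =
      ∫ x, ∫ a, f x a ∂(sj G (τ t) x) ∂(slw G (ofMarkov G τ) t) := by
  unfold stageExp
  simp only [jointLaw_ofMarkov]
  rw [slw, integral_map (f := fun x => ∫ a, f x a ∂(sj G (τ t) x))
    (measurable_lastState X (JA A) t).aemeasurable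
    (Measurable.of_discrete).aestronglyMeasurable]

lemma bound_integrable (x : X) (ν : ∀ j, Measure (A j)) [∀ j, IsProbabilityMeasure (ν j)]
    (hν : ∀ j, ν j (G.As j x) = 1) (f : JA A → ℝ) (hf : Measurable f) (C : ℝ)
    (hC : ∀ a ∈ jointSet G x, |f a| ≤ C) : Integrable f (Measure.pi ν) := by
  refine Integrable.of_bound hf.aestronglyMeasurable C ?_
  filter_upwards [ae_pi_mem G x ν hν] with a ha using hC a ha

lemma exists_cond (i : Fin n) {Ω : Type*} [MeasurableSpace Ω] (H : Measure Ω)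
    [IsProbabilityMeasure H] (last : Ω → X) (hlast : Measurable last)
    (κ : Kernel Ω (A i)) [IsMarkovKernel κ] (hκ : ∀ h, κ h (G.As i (last h)) = 1) :
    ∃ ψ : Stat G i,
      (∀ F : X × A i → ℝ≥0∞, Measurable F → ∫⁻ h, ∫⁻ a, F (last h, a) ∂(κ h) ∂H =
        ∫⁻ x, ∫⁻ a, F (x, a) ∂(sl G ψ x) ∂(H.map last)) ∧
      (∀ F : X × A i → ℝ, Measurable F → ∀ w : X → ℝ, Integrable w (H.map last) →
        (∀ x a, a ∈ G.As i x → |F (x, a)| ≤ w x) →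
        ∫ h, ∫ a, F (last h, a) ∂(κ h) ∂H = ∫ x, ∫ a, F (x, a) ∂(sl G ψ x) ∂(H.map last)) := by
  classical
  obtain ⟨h0⟩ : Nonempty Ω := H.nonempty_of_neZero
  haveI : Nonempty (A i) := ⟨(G.hAs_ne i (last h0)).some⟩
  have hm : Measurable fun q : Ω × A i => (last q.1, q.2) :=
    (hlast.comp measurable_fst).prodMk measurable_snd
  set ρ : Measure (X × A i) := (H ⊗ₘ κ).map (fun q => (last q.1, q.2)) with hR
  haveI : IsProbabilityMeasure ρ := Measure.isProbabilityMeasure_map hm.aemeasurable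
  have hfst : ρ.fst = H.map last := by
    rw [Measure.fst, hR, Measure.map_map measurable_fst hm]
    have h1 : (Prod.fst ∘ fun q : Ω × A i => (last q.1, q.2)) = last ∘ Prod.fst := rfl
    rw [h1, ← Measure.map_map hlast measurable_fst, ← Measure.fst, Measure.fst_compProd]
  have hset : MeasurableSet {q : X × A i | q.2 ∈ G.As i q.1} := by
    have : {q : X × A i | q.2 ∈ G.As i q.1} = ⋃ x : X, {x} ×ˢ G.As i x := by
      ext ⟨x, a⟩; simp
    rw [this]
    exact MeasurableSet.iUnion fun x => (measurableSet_singleton x).prod (measurableSet_As G i x)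
  have hRsupp : ∀ᵐ q ∂ρ, q.2 ∈ G.As i q.1 := by
    rw [hR, ae_map_iff hm.aemeasurable hset]
    refine Measure.ae_compProd_of_ae_ae (hm hset) ?_
    refine Eventually.of_forall fun h => ?_
    exact (mem_ae_iff_prob_eq_one (measurableSet_As G i _)).2 (hκ h)
  have hdis := ρ.disintegrate ρ.condKernel
  have hcond : ∀ᵐ x ∂ρ.fst, ρ.condKernel x (G.As i x) = 1 := by
    rw [← hdis] at hRsupp
    have := Measure.ae_ae_of_ae_compProd hRsupp
    filter_upwards [this] with x hx
    exact (mem_ae_iff_prob_eq_one (measurableSet_As G i _)).1 hx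
  obtain ⟨ψ, hψ⟩ := exists_stat G i (fun x => if ρ.condKernel x (G.As i x) = 1 then ρ.condKernel x
      else Measure.dirac (G.hAs_ne i x).some)
    (fun x => by split_ifs <;> infer_instance)
    (fun x => by
      split_ifs with h
      · exact h
      · exact Measure.dirac_apply_of_mem (G.hAs_ne i x).some_mem)
  have hψ' : ∀ᵐ x ∂ρ.fst, ρ.condKernel x = sl G ψ x := by
    filter_upwards [hcond] with x hx
    rw [hψ, if_pos hx]
  refine ⟨ψ, ?_, ?_⟩
  · intro F hF
    have h0 := Measure.lintegral_compProd (μ := H) (κ := κ) (hF.comp hm)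
    simp only [Function.comp_apply] at h0
    rw [← h0, ← hfst]
    have : ∫⁻ q, F (last q.1, q.2) ∂(H ⊗ₘ κ) = ∫⁻ q, F q ∂ρ := by
      rw [hR, lintegral_map hF hm]
    refine this.trans ?_
    conv_lhs => rw [← hdis]
    rw [Measure.lintegral_compProd hF]
    refine lintegral_congr_ae ?_
    filter_upwards [hψ'] with x hx
    rw [hx]
  · intro F hF w hw hFw
    have hIntg : Integrable F ρ := by
      have hw2 : Integrable (fun q : X × A i => w q.1) ρ := by
        rw [← hfst] at hw
        rw [Measure.fst] at hw
        exact (integrable_map_measure (Measurable.of_discrete).aestronglyMeasurable measurable_fst.aemeasurable).1 hw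
      refine hw2.mono' hF.aestronglyMeasurable ?_
      filter_upwards [hRsupp] with q hq using hFw q.1 q.2 hq
    have hint2 : Integrable (fun q => F (last q.1, q.2)) (H ⊗ₘ κ) :=
      (integrable_map_measure hF.aestronglyMeasurable hm.aemeasurable).1 hIntg
    rw [← Measure.integral_compProd hint2, ← hfst]
    have : ∫ q, F (last q.1, q.2) ∂(H ⊗ₘ κ) = ∫ q, F q ∂ρ := by
      rw [hR, integral_map hm.aemeasurable hF.aestronglyMeasurable]
    refine this.trans ?_
    conv_lhs => rw [← hdis]
    rw [Measure.integral_compProd (by rw [hdis]; exact hIntg)]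
    refine integral_congr_ae ?_
    filter_upwards [hψ'] with x hx
    rw [hx]

lemma jointLaw_combine (φ : StatProfile G) (i : Fin n) (σ : Strategy G i) (t : ℕ)
    (h : Hist X (JA A) t) : jointLaw G (combine G (ofStatAll G φ) i σ) t h =
      Measure.pi (Function.update (fun j => sl G (φ j) (lastState X (JA A) t h)) i
        (σ.f t h : Measure (A i))) := by
  unfold jointLaw combine
  congr 1
  funext j
  rcases eq_or_ne j i with rfl | hj
  · simp
  · simp only [Function.update_of_ne hj]
    rfl

lemma sj_update (φ : StatProfile G) (i : Fin n) (ψ : Stat G i) (x : X) :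
    sj G (Function.update φ i ψ) x =
      Measure.pi (Function.update (fun j => sl G (φ j) x) i (sl G ψ x)) := by
  unfold sj
  congr 1
  funext j
  rcases eq_or_ne j i with rfl | hj
  · simp
  · simp only [Function.update_of_ne hj]

lemma update_supp (φ : StatProfile G) (i : Fin n) (x : X) (μ : Measure (A i))
    (hμ : μ (G.As i x) = 1) (j : Fin n) :
    Function.update (fun j => sl G (φ j) x) i μ j (G.As j x) = 1 := by
  rcases eq_or_ne j i with rfl | hj
  · simpa using hμ
  · simpa [Function.update_of_ne hj] using stat_supp G j (φ j) x

theorem markov_reduction (φ : StatProfile G) (i : Fin n) (σ : Strategy G i) (w : X → ℝ)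
    (hw : ∀ t, Integrable w (slw G (combine G (ofStatAll G φ) i σ) t)) :
    ∃ ψ : ℕ → Stat G i, ∀ f : X → JA A → ℝ, (∀ x, Measurable (f x)) →
      (∀ x a, a ∈ jointSet G x → |f x a| ≤ w x) →
      Jfun G G.η f (combine G (ofStatAll G φ) i σ) =
        Jfun G G.η f (ofMarkov G fun t => Function.update φ i (ψ t)) := by
  set π := combine G (ofStatAll G φ) i σ with hπ
  have hκm : ∀ t, Measurable fun h : Hist X (JA A) t => (σ.f t h : Measure (A i)) := fun t =>
    Measure.measurable_of_measurable_coe _ fun s hs => σ.meas t s hs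
  let κ : ∀ t, Kernel (Hist X (JA A) t) (A i) := fun t => ⟨_, hκm t⟩
  haveI : ∀ t, IsMarkovKernel (κ t) := fun t => ⟨fun h => (σ.f t h).2⟩
  choose ψ hψ1 hψ2 using fun t => exists_cond G i (histMeas G G.η π t) (lastState X (JA A) t)
    (measurable_lastState X (JA A) t) (κ t) (fun h => strat_supp G i σ t h)
  set τ : ℕ → StatProfile G := fun t => Function.update φ i (ψ t) with hτ
  have hlaw : ∀ t, slw G π t = slw G (ofMarkov G τ) t := by
    intro t
    induction t with
    | zero => rw [slw_zero, slw_zero]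
    | succ t ih =>
      refine Measure.ext_of_singleton fun y => ?_
      rw [slw_succ, slw_succ_markov, ← ih]
      have hF : Measurable fun q : X × A i =>
          ∫⁻ b, G.p q.1 (Function.update b i q.2) {y} ∂(sj G φ q.1) := by
        refine measurable_from_prod_countable_right fun x => ?_
        exact Measurable.lintegral_prod_right'
          (ν := sj G φ x) (f := fun q : A i × JA A => G.p x (Function.update q.2 i q.1) {y})
          ((G.hpm x y).comp (measurable_upd i))
      have h1 := hψ1 t _ hF
      simp only [hπ, jointLaw_combine]
      refine Eq.trans ?_ (h1.trans ?_)
      · refine lintegral_congr fun h => ?_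
        exact lintegral_pi_update _ i _ _ (G.hpm _ y)
      · refine lintegral_congr fun x => ?_
        simp only [hτ, sj_update]
        exact (lintegral_pi_update _ i _ _ (G.hpm _ y)).symm
  refine ⟨ψ, fun f hf hfw => ?_⟩
  unfold Jfun
  congr 1
  refine tsum_congr fun t => ?_
  congr 1
  rw [stageExp_markov, ← hlaw]
  have hF : Measurable fun q : X × A i =>
      ∫ b, f q.1 (Function.update b i q.2) ∂(sj G φ q.1) := by
    refine measurable_from_prod_countable_right fun x => ?_
    exact (StronglyMeasurable.integral_prod_right'
      (ν := sj G φ x) (f := fun q : A i × JA A => f x (Function.update q.2 i q.1))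
      (((hf x).comp (measurable_upd i)).stronglyMeasurable)).measurable
  have h1 := hψ2 t _ hF w (hw t) (by
    intro x a ha
    have := norm_integral_le_of_norm_le_const (μ := sj G φ x) (C := w x)
      (f := fun b => f x (Function.update b i a)) (by
        filter_upwards [sj_ae G φ x] with b hb using hfw x _ (update_mem G hb ha))
    simpa using this)
  unfold stageExp
  refine Eq.trans ?_ (h1.trans ?_)
  · refine integral_congr_ae (Eventually.of_forall fun h => ?_)
    simp only [hπ, jointLaw_combine]
    exact (integral_pi_update _ i _ _ (hf _) (bound_integrable G _ _
      (update_supp G φ i _ _ (strat_supp G i σ t h)) _ (hf _) _ (hfw _))).2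
  · refine integral_congr_ae (Eventually.of_forall fun x => ?_)
    simp only [hτ, sj_update]
    exact (integral_pi_update _ i _ _ (hf _) (bound_integrable G _ _
      (update_supp G φ i _ _ (stat_supp G i (ψ t) x)) _ (hf _) _ (hfw _))).2.symm

end CSGame

open MeasureTheory ProbabilityTheory Filter Topology
open scoped ENNReal NNReal

namespace CSGame

set_option linter.unusedSectionVars false
set_option linter.style.haveILetI false
set_option linter.unusedSimpArgs false

variable {n l : ℕ}
variable {X : Type} [Countable X] [MeasurableSpace X] [DiscreteMeasurableSpace X]
  [TopologicalSpace X] [DiscreteTopology X] [BorelSpace X] [SecondCountableTopology X]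
variable {A : Fin n → Type} [∀ i, MeasurableSpace (A i)] [∀ i, TopologicalSpace (A i)]
  [∀ i, PolishSpace (A i)] [∀ i, BorelSpace (A i)]
variable (G : GameData n l X A)

section RealLemmas

open Finset in
lemma tendsto_tsum_of_tails {M Y : Type*} (u : Filter M) (a : M → Y → ℝ) (b : Y → ℝ)
    (hb : Summable b) (hab : ∀ x, Tendsto (fun m => a m x) u (𝓝 (b x)))
    (ht : ∀ ε > 0, ∃ F : Finset Y, ∀ F', F ⊆ F' → ∀ᶠ m in u, |∑' x, a m x - ∑ x ∈ F', a m x| ≤ ε) :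
    Tendsto (fun m => ∑' x, a m x) u (𝓝 (∑' x, b x)) := by
  classical
  rw [Metric.tendsto_nhds]
  intro ε hε
  obtain ⟨F, hF⟩ := ht (ε / 4) (by positivity)
  have h1 := Metric.tendsto_nhds.1 hb.hasSum (ε / 4) (by positivity)
  obtain ⟨F2, hF2⟩ := Filter.eventually_atTop.1 h1
  have h2 := hF2 (F ∪ F2) Finset.subset_union_right
  have h3 : Tendsto (fun m => ∑ x ∈ F ∪ F2, a m x) u (𝓝 (∑ x ∈ F ∪ F2, b x)) :=
    tendsto_finsetSum _ fun x _ => hab x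
  have h4 := Metric.tendsto_nhds.1 h3 (ε / 4) (by positivity)
  filter_upwards [hF (F ∪ F2) Finset.subset_union_left, h4] with m h5 h6
  rw [Real.dist_eq] at *
  have e1 := abs_le.1 h5
  have e2 := abs_lt.1 h6
  have e3 := abs_lt.1 h2
  rw [abs_lt]
  constructor <;> linarith [e1.1, e1.2, e2.1, e2.2, e3.1, e3.2]

lemma tail_eq {Y : Type*} [DecidableEq Y] (a : Y → ℝ) (ha : Summable a) (F : Finset Y) :
    ∑' x, a x - ∑ x ∈ F, a x = ∑' x, (if x ∈ F then 0 else a x) := by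
  have h1 : Summable (fun x => if x ∈ F then a x else 0) :=
    summable_of_ne_finset_zero (s := F) fun x hx => by simp [hx]
  have h2 : ∑' x, (if x ∈ F then a x else 0) = ∑ x ∈ F, a x := by
    rw [tsum_eq_sum (s := F) fun x hx => by simp [hx]]
    exact Finset.sum_congr rfl fun x hx => by simp [hx]
  rw [← h2, ← ha.tsum_sub h1]
  refine tsum_congr fun x => ?_
  split_ifs <;> simp

theorem space_conv {M Y : Type*} (u : Filter M) (k : M → Y → ℝ) (μ : Y → ℝ) (g : M → Y → ℝ)
    (g0 : Y → ℝ) (w : Y → ℝ)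
    (hk0 : ∀ m x, 0 ≤ k m x) (hks : ∀ m, Summable (k m)) (hk1 : ∀ m, ∑' x, k m x ≤ 1)
    (hμ : HasSum μ 1) (hkμ : ∀ x, Tendsto (fun m => k m x) u (𝓝 (μ x)))
    (hg : ∀ x, Tendsto (fun m => g m x) u (𝓝 (g0 x)))
    (hgw : ∀ m x, |g m x| ≤ w x)
    (hkw : ∀ m, Summable fun x => k m x * w x)
    (hUI : ∀ ε > 0, ∃ K : ℝ, 0 ≤ K ∧ ∀ m, ∑' x, (if K ≤ w x then k m x * w x else 0) ≤ ε)
    (hs : Summable fun x => μ x * g0 x) :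
    Tendsto (fun m => ∑' x, k m x * g m x) u (𝓝 (∑' x, μ x * g0 x)) := by
  classical
  have hw0 : ∀ m x, 0 ≤ k m x * w x := fun m x =>
    mul_nonneg (hk0 m x) ((abs_nonneg _).trans (hgw m x))
  have hsm : ∀ m, Summable fun x => k m x * g m x := fun m => by
    refine Summable.of_norm_bounded (hkw m) fun x => ?_
    rw [Real.norm_eq_abs, abs_mul, abs_of_nonneg (hk0 m x)]
    exact mul_le_mul_of_nonneg_left (hgw m x) (hk0 m x)
  refine tendsto_tsum_of_tails u _ _ hs (fun x => (hkμ x).mul (hg x)) fun ε hε => ?_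
  obtain ⟨K, hK0, hK⟩ := hUI (ε / 2) (by positivity)
  have h1 := Metric.tendsto_nhds.1 hμ (ε / (4 * (K + 1))) (by positivity)
  obtain ⟨F, hF⟩ := Filter.eventually_atTop.1 h1
  have hF := hF F le_rfl
  refine ⟨F, fun F' hFF => ?_⟩
  have h3 : Tendsto (fun m => ∑ x ∈ F, k m x) u (𝓝 (∑ x ∈ F, μ x)) :=
    tendsto_finsetSum _ fun x _ => hkμ x
  filter_upwards [Metric.tendsto_nhds.1 h3 (ε / (4 * (K + 1))) (by positivity)] with m hm
  rw [tail_eq _ (hsm m)]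
  have hsw : Summable fun x => if K ≤ w x then k m x * w x else 0 :=
    Summable.of_nonneg_of_le (fun x => by split_ifs; exacts [hw0 m x, le_rfl])
      (fun x => by split_ifs; exacts [le_rfl, hw0 m x]) (hkw m)
  have hs1 : Summable fun x => if x ∈ F' then 0 else k m x :=
    Summable.of_nonneg_of_le (fun x => by split_ifs; exacts [le_rfl, hk0 m x])
      (fun x => by split_ifs; exacts [hk0 m x, le_rfl]) (hks m)
  have hb : ∀ x, ‖if x ∈ F' then 0 else k m x * g m x‖ ≤
      K * (if x ∈ F' then 0 else k m x) + if K ≤ w x then k m x * w x else 0 := by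
    intro x
    by_cases hx : x ∈ F'
    · simp only [hx, if_true, norm_zero, mul_zero, zero_add]
      split_ifs; exacts [hw0 m x, le_rfl]
    · simp only [hx, if_false, Real.norm_eq_abs, abs_mul, abs_of_nonneg (hk0 m x)]
      have := mul_le_mul_of_nonneg_left (hgw m x) (hk0 m x)
      have h0 := mul_nonneg hK0 (hk0 m x)
      split_ifs with h
      · linarith
      · have : k m x * |g m x| ≤ k m x * K :=
          mul_le_mul_of_nonneg_left ((hgw m x).trans (not_le.1 h).le) (hk0 m x)
        linarith
  have h5 := tsum_of_norm_bounded ((hs1.mul_left K).add hsw).hasSum hb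
  rw [(hs1.mul_left K).tsum_add hsw, tsum_mul_left, ← tail_eq _ (hks m)] at h5
  have h6 : ∑ x ∈ F, k m x ≤ ∑ x ∈ F', k m x :=
    Finset.sum_le_sum_of_subset_of_nonneg hFF fun x _ _ => hk0 m x
  rw [Real.dist_eq] at hm hF
  have e1 := (abs_lt.1 hm).1
  have e2 := (abs_lt.1 hF).1
  have e3 : ∑' x, k m x - ∑ x ∈ F', k m x ≤ ε / (2 * (K + 1)) := by
    have : ε / (2 * (K + 1)) = ε / (4 * (K + 1)) + ε / (4 * (K + 1)) := by field_simp; norm_num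
    linarith [hk1 m]
  have e4 : K * (∑' x, k m x - ∑ x ∈ F', k m x) ≤ ε / 2 := by
    refine (mul_le_mul_of_nonneg_left e3 hK0).trans ?_
    rw [← mul_div_assoc, div_le_div_iff₀ (by positivity) (by positivity)]
    nlinarith
  rw [Real.norm_eq_abs] at h5
  linarith [hK m]

/-- The sub-stochastic law of a chain killed outside the finite set `S`. -/
noncomputable def kl {Y : Type*} (η : Y → ℝ) (K : ℕ → Y → Y → ℝ) (S : Finset Y) : ℕ → Y → ℝ
  | 0 => fun y => open Classical in if y ∈ S then η y else 0
  | t + 1 => fun y => open Classical in if y ∈ S then ∑ x ∈ S, kl η K S t x * K t x y else 0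

/-- The discounted cost of the killed chain. -/
noncomputable def Jk {Y : Type*} (α : ℝ) (η : Y → ℝ) (K : ℕ → Y → Y → ℝ) (S : Finset Y)
    (f : ℕ → Y → ℝ) : ℝ := (1 - α) * ∑' t, α ^ t * ∑ x ∈ S, kl η K S t x * f t x

variable {Y : Type*} (η : Y → ℝ) (K : ℕ → Y → Y → ℝ) (S : Finset Y)

lemma kl_nonneg (hη : ∀ x, 0 ≤ η x) (hK : ∀ t x y, 0 ≤ K t x y) (t : ℕ) (y : Y) :
    0 ≤ kl η K S t y := by
  induction t generalizing y with
  | zero => simp only [kl]; split_ifs; exacts [hη y, le_rfl]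
  | succ t ih =>
    simp only [kl]; split_ifs
    exacts [Finset.sum_nonneg fun x _ => mul_nonneg (ih x) (hK _ _ _), le_rfl]

lemma kl_zero_out (t : ℕ) (y : Y) (hy : y ∉ S) : kl η K S t y = 0 := by
  cases t <;> simp [kl, hy]

lemma kl_succ (t : ℕ) (y : Y) (hy : y ∈ S) :
    kl η K S (t + 1) y = ∑ x ∈ S, kl η K S t x * K t x y := by
  simp [kl, hy]

lemma kl_sum_le (hη : ∀ x, 0 ≤ η x) (hη1 : ∑ x ∈ S, η x ≤ 1) (hK : ∀ t x y, 0 ≤ K t x y)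
    (hK1 : ∀ t x, ∑ y ∈ S, K t x y ≤ 1) (t : ℕ) : ∑ x ∈ S, kl η K S t x ≤ 1 := by
  induction t with
  | zero =>
    refine le_trans (Finset.sum_le_sum fun x hx => ?_) hη1
    simp [kl, hx]
  | succ t ih =>
    calc ∑ y ∈ S, kl η K S (t + 1) y = ∑ y ∈ S, ∑ x ∈ S, kl η K S t x * K t x y :=
          Finset.sum_congr rfl fun y hy => kl_succ η K S t y hy
      _ = ∑ x ∈ S, kl η K S t x * ∑ y ∈ S, K t x y := by
          rw [Finset.sum_comm]; simp only [Finset.mul_sum]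
      _ ≤ ∑ x ∈ S, kl η K S t x * 1 := Finset.sum_le_sum fun x _ =>
          mul_le_mul_of_nonneg_left (hK1 t x) (kl_nonneg η K S hη hK t x)
      _ ≤ 1 := by simpa using ih

lemma kl_abs_sum (hη : ∀ x, 0 ≤ η x) (hη1 : ∑ x ∈ S, η x ≤ 1) (hK : ∀ t x y, 0 ≤ K t x y)
    (hK1 : ∀ t x, ∑ y ∈ S, K t x y ≤ 1) (t : ℕ) (g : Y → ℝ) (C : ℝ) (hC : 0 ≤ C)
    (hg : ∀ x ∈ S, |g x| ≤ C) : |∑ x ∈ S, kl η K S t x * g x| ≤ C := by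
  calc |∑ x ∈ S, kl η K S t x * g x| ≤ ∑ x ∈ S, |kl η K S t x * g x| :=
        Finset.abs_sum_le_sum_abs _ _
    _ ≤ ∑ x ∈ S, kl η K S t x * C := Finset.sum_le_sum fun x hx => by
        rw [abs_mul, abs_of_nonneg (kl_nonneg η K S hη hK t x)]
        exact mul_le_mul_of_nonneg_left (hg x hx) (kl_nonneg η K S hη hK t x)
    _ ≤ C := by
        rw [← Finset.sum_mul]
        nlinarith [kl_sum_le η K S hη hη1 hK hK1 t]

theorem kl_verify (α : ℝ) (hα0 : 0 < α) (hα1 : α < 1)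
    (hη : ∀ x, 0 ≤ η x) (hη1 : ∑ x ∈ S, η x ≤ 1) (hK : ∀ t x y, 0 ≤ K t x y)
    (hK1 : ∀ t x, ∑ y ∈ S, K t x y ≤ 1) (f : ℕ → Y → ℝ) (V : Y → ℝ) (ε : ℝ) (hε : 0 ≤ ε)
    (C : ℝ) (hC : 0 ≤ C) (hf : ∀ t, ∀ x ∈ S, |f t x| ≤ C)
    (hV : ∀ t, ∀ x ∈ S, V x ≤ (1 - α) * f t x + α * ∑ y ∈ S, K t x y * V y + ε) :
    ∑ x ∈ S, η x * V x ≤ Jk α η K S f + ε / (1 - α) := by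
  set s : ℕ → ℝ := fun t => ∑ x ∈ S, kl η K S t x * f t x with hs
  have hstep : ∀ t, ∑ x ∈ S, kl η K S t x * V x ≤
      (1 - α) * s t + ε + α * ∑ x ∈ S, kl η K S (t + 1) x * V x := by
    intro t
    have e1 : ∑ x ∈ S, kl η K S (t + 1) x * V x =
        ∑ x ∈ S, kl η K S t x * ∑ y ∈ S, K t x y * V y := by
      rw [Finset.sum_congr rfl fun y hy => by rw [kl_succ η K S t y hy]]
      simp only [Finset.sum_mul, Finset.mul_sum]
      rw [Finset.sum_comm]
      exact Finset.sum_congr rfl fun x _ => Finset.sum_congr rfl fun y _ => by ring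
    have e2 : ∑ x ∈ S, kl η K S t x * V x ≤ ∑ x ∈ S, kl η K S t x *
        ((1 - α) * f t x + α * ∑ y ∈ S, K t x y * V y + ε) := Finset.sum_le_sum fun x hx =>
      mul_le_mul_of_nonneg_left (hV t x hx) (kl_nonneg η K S hη hK t x)
    have e3 : ∑ x ∈ S, kl η K S t x * ((1 - α) * f t x + α * ∑ y ∈ S, K t x y * V y + ε) =
        (1 - α) * s t + α * ∑ x ∈ S, kl η K S t x * ∑ y ∈ S, K t x y * V y +
          (∑ x ∈ S, kl η K S t x) * ε := by
      simp only [hs, Finset.mul_sum (a := (1 - α)), Finset.mul_sum (a := α), Finset.sum_mul,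
        ← Finset.sum_add_distrib]
      exact Finset.sum_congr rfl fun x _ => by rw [← Finset.mul_sum]; ring
    rw [e1]
    have e4 := mul_le_mul_of_nonneg_right (kl_sum_le η K S hη hη1 hK hK1 t) hε
    linarith
  have hit : ∀ T, ∑ x ∈ S, η x * V x ≤ ∑ t ∈ Finset.range T, α ^ t * ((1 - α) * s t + ε) +
      α ^ T * ∑ x ∈ S, kl η K S T x * V x := by
    intro T
    induction T with
    | zero =>
      simp only [Finset.range_zero, Finset.sum_empty, pow_zero, one_mul, zero_add]
      refine (Finset.sum_congr rfl fun x hx => ?_).le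
      simp [kl, hx]
    | succ T ih =>
      rw [Finset.sum_range_succ, pow_succ]
      have := mul_le_mul_of_nonneg_left (hstep T) (pow_nonneg hα0.le T)
      nlinarith
  have hsb : ∀ t, |s t| ≤ C := fun t => kl_abs_sum η K S hη hη1 hK hK1 t _ C hC (hf t)
  have hgeo := summable_geometric_of_lt_one hα0.le hα1
  have hsum : Summable fun t => α ^ t * s t := by
    refine Summable.of_norm_bounded (hgeo.mul_right C) fun t => ?_
    rw [Real.norm_eq_abs, abs_mul, abs_of_nonneg (pow_nonneg hα0.le t)]
    exact mul_le_mul_of_nonneg_left (hsb t) (pow_nonneg hα0.le t)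
  have hH : HasSum (fun t => α ^ t * ((1 - α) * s t + ε)) (Jk α η K S f + ε / (1 - α)) := by
    have h1 := (hsum.hasSum.mul_left (1 - α)).add
      ((hasSum_geometric_of_lt_one hα0.le hα1).mul_right ε)
    have e1 : (fun t => α ^ t * ((1 - α) * s t + ε)) =
        fun b => (1 - α) * (α ^ b * s b) + α ^ b * ε := by funext t; ring
    have e2 : Jk α η K S f + ε / (1 - α) =
        (1 - α) * ∑' b, α ^ b * s b + (1 - α)⁻¹ * ε := by
      unfold Jk; rw [div_eq_inv_mul]
    rw [e1, e2]
    exact h1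
  have hD : Tendsto (fun T => α ^ T * ∑ x ∈ S, kl η K S T x * V x) atTop (𝓝 0) := by
    set D := ∑ x ∈ S, |V x|
    have h0 : Tendsto (fun T : ℕ => α ^ T * D) atTop (𝓝 0) := by
      simpa using (tendsto_pow_atTop_nhds_zero_of_lt_one hα0.le hα1).mul_const D
    refine squeeze_zero_norm (fun T => ?_) h0
    rw [Real.norm_eq_abs, abs_mul, abs_of_nonneg (pow_nonneg hα0.le T)]
    refine mul_le_mul_of_nonneg_left ?_ (pow_nonneg hα0.le T)
    exact kl_abs_sum η K S hη hη1 hK hK1 T _ D (Finset.sum_nonneg fun _ _ => abs_nonneg _)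
      fun x hx => Finset.single_le_sum (f := fun x => |V x|) (fun _ _ => abs_nonneg _) hx
  have := hH.tendsto_sum_nat.add hD
  rw [add_zero] at this
  exact ge_of_tendsto' this hit

lemma Jk_neg (α : ℝ) (f : ℕ → Y → ℝ) : Jk α η K S (fun t x => - f t x) = - Jk α η K S f := by
  simp [Jk, tsum_neg, Finset.sum_neg_distrib]

theorem kl_verify_eq (α : ℝ) (hα0 : 0 < α) (hα1 : α < 1)
    (hη : ∀ x, 0 ≤ η x) (hη1 : ∑ x ∈ S, η x ≤ 1) (hK : ∀ t x y, 0 ≤ K t x y)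
    (hK1 : ∀ t x, ∑ y ∈ S, K t x y ≤ 1) (f : ℕ → Y → ℝ) (V : Y → ℝ)
    (C : ℝ) (hC : 0 ≤ C) (hf : ∀ t, ∀ x ∈ S, |f t x| ≤ C)
    (hV : ∀ t, ∀ x ∈ S, V x = (1 - α) * f t x + α * ∑ y ∈ S, K t x y * V y) :
    ∑ x ∈ S, η x * V x = Jk α η K S f := by
  refine le_antisymm ?_ ?_
  · have := kl_verify η K S α hα0 hα1 hη hη1 hK hK1 f V 0 le_rfl C hC hf
      (fun t x hx => by rw [add_zero]; exact (hV t x hx).le)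
    simpa using this
  · have := kl_verify η K S α hα0 hα1 hη hη1 hK hK1 (fun t x => - f t x) (fun x => - V x)
      0 le_rfl C hC (by simpa using hf) (fun t x hx => by
        rw [add_zero]; simp only [mul_neg, Finset.sum_neg_distrib]; rw [hV t x hx]; linarith)
    rw [Jk_neg] at this
    simp only [mul_neg, Finset.sum_neg_distrib, zero_div, add_zero] at this
    linarith

lemma Jk_summable (α : ℝ) (hα0 : 0 < α) (hα1 : α < 1)
    (hη : ∀ x, 0 ≤ η x) (hη1 : ∑ x ∈ S, η x ≤ 1) (hK : ∀ t x y, 0 ≤ K t x y)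
    (hK1 : ∀ t x, ∑ y ∈ S, K t x y ≤ 1) (f : ℕ → Y → ℝ)
    (C : ℝ) (hC : 0 ≤ C) (hf : ∀ t, ∀ x ∈ S, |f t x| ≤ C) :
    Summable fun t => α ^ t * ∑ x ∈ S, kl η K S t x * f t x := by
  refine Summable.of_norm_bounded ((summable_geometric_of_lt_one hα0.le hα1).mul_right C)
    fun t => ?_
  rw [Real.norm_eq_abs, abs_mul, abs_of_nonneg (pow_nonneg hα0.le t)]
  exact mul_le_mul_of_nonneg_left (kl_abs_sum η K S hη hη1 hK hK1 t _ C hC (hf t))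
    (pow_nonneg hα0.le t)

lemma Jk_lin (α : ℝ) (hα0 : 0 < α) (hα1 : α < 1)
    (hη : ∀ x, 0 ≤ η x) (hη1 : ∑ x ∈ S, η x ≤ 1) (hK : ∀ t x y, 0 ≤ K t x y)
    (hK1 : ∀ t x, ∑ y ∈ S, K t x y ≤ 1) {I : Type*} (L : Finset I) (lam : I → ℝ)
    (f : I → ℕ → Y → ℝ)
    (C : ℝ) (hC : 0 ≤ C) (hf : ∀ i t, ∀ x ∈ S, |f i t x| ≤ C) :
    Jk α η K S (fun t x => ∑ i ∈ L, lam i * f i t x) = ∑ i ∈ L, lam i * Jk α η K S (f i) := by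
  have h : HasSum (fun t => α ^ t * ∑ x ∈ S, kl η K S t x * ∑ i ∈ L, lam i * f i t x)
      (∑ i ∈ L, lam i * ∑' t, α ^ t * ∑ x ∈ S, kl η K S t x * f i t x) := by
    have := hasSum_sum (s := L) fun i _ => ((Jk_summable η K S α hα0 hα1 hη hη1 hK hK1 (f i) C hC
      (hf i)).hasSum.mul_left (lam i))
    have e1 : (fun t => α ^ t * ∑ x ∈ S, kl η K S t x * ∑ i ∈ L, lam i * f i t x) =
        fun t => ∑ i ∈ L, lam i * (α ^ t * ∑ x ∈ S, kl η K S t x * f i t x) := by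
      funext t
      simp only [Finset.mul_sum]
      rw [Finset.sum_comm]
      exact Finset.sum_congr rfl fun x _ => Finset.sum_congr rfl fun y _ => by ring
    rw [e1]
    exact this
  unfold Jk
  rw [h.tsum_eq, Finset.mul_sum]
  exact Finset.sum_congr rfl fun x _ => by ring

theorem Jk_conv {M : Type*} (u : Filter M) (α : ℝ) (hα0 : 0 < α)
    (hη : ∀ x, 0 ≤ η x) (hη1 : HasSum η 1)
    (Km : M → ℕ → Y → Y → ℝ) (hKm : ∀ m t x y, 0 ≤ Km m t x y)
    (hKm1 : ∀ m t x (F : Finset Y), ∑ y ∈ F, Km m t x y ≤ 1)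
    (hKK : ∀ t x y, Tendsto (fun m => Km m t x y) u (𝓝 (K t x y)))
    (Sm : M → Finset Y) (hS : ∀ y, ∀ᶠ m in u, y ∈ Sm m)
    (fm : M → ℕ → Y → ℝ) (f : ℕ → Y → ℝ) (w : Y → ℝ) (hfm : ∀ m t x, |fm m t x| ≤ w x)
    (hff : ∀ t x, Tendsto (fun m => fm m t x) u (𝓝 (f t x)))
    (D : M → ℕ → Y → ℝ) (hD : ∀ m t x, kl η (Km m) (Sm m) t x ≤ D m t x)
    (hDw : ∀ m t, Summable fun x => D m t x * w x)
    (hUI : ∀ t, ∀ ε > 0, ∃ Q : ℝ, 0 ≤ Q ∧ ∀ m, ∑' x, (if Q ≤ w x then D m t x * w x else 0) ≤ ε)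
    (hDt : ∀ m, Summable fun t => α ^ t * ∑' x, D m t x * w x)
    (htail : ∀ ε > 0, ∃ T : ℕ, ∀ m, ∑' t, (if T ≤ t then α ^ t * ∑' x, D m t x * w x else 0) ≤ ε)
    (μ : ℕ → Y → ℝ) (hμ0 : μ 0 = η)
    (hμs : ∀ t y, HasSum (fun x => μ t x * K t x y) (μ (t + 1) y)) (hμ1 : ∀ t, HasSum (μ t) 1)
    (hμf : ∀ t, Summable fun x => μ t x * f t x)
    (hμt : Summable fun t => α ^ t * ∑' x, μ t x * f t x) :
    Tendsto (fun m => Jk α η (Km m) (Sm m) (fm m)) u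
      (𝓝 ((1 - α) * ∑' t, α ^ t * ∑' x, μ t x * f t x)) := by
  classical
  have hw0 : ∀ m : M, ∀ x, 0 ≤ w x := fun m x => (abs_nonneg _).trans (hfm m 0 x)
  have hk0 := fun m => kl_nonneg η (Km m) (Sm m) hη (hKm m)
  have hout := fun m => kl_zero_out η (Km m) (Sm m)
  have hksum : ∀ m t (g : Y → ℝ), ∑' x, kl η (Km m) (Sm m) t x * g x =
      ∑ x ∈ Sm m, kl η (Km m) (Sm m) t x * g x := fun m t g =>
    tsum_eq_sum fun x hx => by rw [hout m t x hx, zero_mul]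
  have hks : ∀ m t (g : Y → ℝ), Summable fun x => kl η (Km m) (Sm m) t x * g x := fun m t g =>
    summable_of_ne_finset_zero (s := Sm m) fun x hx => by rw [hout m t x hx, zero_mul]
  have hks1 : ∀ m t, Summable fun x => kl η (Km m) (Sm m) t x := fun m t => by
    simpa using hks m t (fun _ => 1)
  have hle1 : ∀ m t, ∑' x, kl η (Km m) (Sm m) t x ≤ 1 := fun m t => by
    have h1 := hksum m t (fun _ => 1)
    simp only [mul_one] at h1
    rw [h1]
    exact kl_sum_le η (Km m) (Sm m) hη (sum_le_hasSum _ (fun x _ => hη x) hη1) (hKm m)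
      (fun t x => hKm1 m t x _) t
  have hKle : ∀ m t x y, |Km m t x y| ≤ 1 := fun m t x y => by
    rw [abs_of_nonneg (hKm m t x y)]
    simpa using hKm1 m t x {y}
  have hlaw : ∀ t y, Tendsto (fun m => kl η (Km m) (Sm m) t y) u (𝓝 (μ t y)) := by
    intro t
    induction t with
    | zero =>
      intro y
      rw [hμ0]
      refine tendsto_const_nhds.congr' ?_
      filter_upwards [hS y] with m hm
      simp [kl, hm]
    | succ t ih =>
      intro y
      have h1 := space_conv u (fun m => kl η (Km m) (Sm m) t) (μ t) (fun m x => Km m t x y)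
        (fun x => K t x y) (fun _ => 1) (fun m x => hk0 m t x) (fun m => hks1 m t)
        (fun m => hle1 m t) (hμ1 t) ih (fun x => hKK t x y) (fun m x => hKle m t x y)
        (fun m => by simpa using hks1 m t)
        (fun ε hε => ⟨2, by norm_num, fun m => by norm_num; exact hε.le⟩) (hμs t y).summable
      rw [(hμs t y).tsum_eq] at h1
      refine h1.congr' ?_
      filter_upwards [hS y] with m hm
      rw [hksum, kl_succ _ _ _ _ _ hm]
  have hstage : ∀ t, Tendsto (fun m => ∑ x ∈ Sm m, kl η (Km m) (Sm m) t x * fm m t x) u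
      (𝓝 (∑' x, μ t x * f t x)) := by
    intro t
    have h1 := space_conv u (fun m => kl η (Km m) (Sm m) t) (μ t) (fun m x => fm m t x)
        (fun x => f t x) w (fun m x => hk0 m t x) (fun m => hks1 m t)
        (fun m => hle1 m t) (hμ1 t) (hlaw t) (fun x => hff t x) (fun m x => hfm m t x)
        (fun m => hks m t w)
        (fun ε hε => by
          obtain ⟨Q, hQ, hQ2⟩ := hUI t ε hε
          refine ⟨Q, hQ, fun m => le_trans ?_ (hQ2 m)⟩
          have hD0 : ∀ x, 0 ≤ D m t x * w x := fun x =>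
            mul_nonneg ((hk0 m t x).trans (hD m t x)) (hw0 m x)
          refine Summable.tsum_le_tsum (fun x => ?_) ?_ ?_
          · split_ifs
            · exact mul_le_mul_of_nonneg_right (hD m t x) (hw0 m x)
            · exact le_rfl
          · exact summable_of_ne_finset_zero (s := Sm m) fun x hx => by
              rw [hout m t x hx]; simp
          · exact Summable.of_nonneg_of_le (fun x => by split_ifs; exacts [hD0 x, le_rfl])
              (fun x => by split_ifs; exacts [le_rfl, hD0 x]) (hDw m t)) (hμf t)
    refine h1.congr fun m => ?_
    rw [hksum]
  have hbd : ∀ m t, |α ^ t * ∑ x ∈ Sm m, kl η (Km m) (Sm m) t x * fm m t x| ≤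
      α ^ t * ∑' x, D m t x * w x := by
    intro m t
    rw [abs_mul, abs_of_nonneg (pow_nonneg hα0.le t), ← hksum]
    refine mul_le_mul_of_nonneg_left ?_ (pow_nonneg hα0.le t)
    rw [← Real.norm_eq_abs]
    refine tsum_of_norm_bounded (hDw m t).hasSum fun x => ?_
    rw [Real.norm_eq_abs, abs_mul, abs_of_nonneg (hk0 m t x)]
    exact mul_le_mul (hD m t x) (hfm m t x) (abs_nonneg _) ((hk0 m t x).trans (hD m t x))
  unfold Jk
  refine Tendsto.const_mul _ ?_
  refine tendsto_tsum_of_tails u _ _ hμt (fun t => (hstage t).const_mul _) fun ε hε => ?_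
  obtain ⟨T, hT⟩ := htail ε hε
  refine ⟨Finset.range T, fun F' hF => Eventually.of_forall fun m => ?_⟩
  have hsm : Summable fun t => α ^ t * ∑ x ∈ Sm m, kl η (Km m) (Sm m) t x * fm m t x :=
    Summable.of_norm_bounded (hDt m) fun t => hbd m t
  have hpos : ∀ t, 0 ≤ α ^ t * ∑' x, D m t x * w x := fun t => (abs_nonneg _).trans (hbd m t)
  have hsi : Summable fun t => if T ≤ t then α ^ t * ∑' x, D m t x * w x else 0 :=
    Summable.of_nonneg_of_le (fun x => by split_ifs; exacts [hpos x, le_rfl])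
      (fun x => by split_ifs; exacts [le_rfl, hpos x]) (hDt m)
  rw [tail_eq _ hsm, ← Real.norm_eq_abs]
  refine (tsum_of_norm_bounded hsi.hasSum fun t => ?_).trans (hT m)
  by_cases ht : t ∈ F'
  · simp only [ht, if_true, norm_zero]
    split_ifs; exacts [hpos t, le_rfl]
  · have : T ≤ t := by
      by_contra h
      exact ht (hF (Finset.mem_range.2 (not_le.1 h)))
    simp only [ht, this, if_true, if_false]
    exact hbd m t

end RealLemmas

end CSGame

open MeasureTheory ProbabilityTheory Filter Topology
open scoped ENNReal NNReal

namespace CSGame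

set_option linter.unusedSectionVars false
set_option linter.style.haveILetI false
set_option linter.unusedSimpArgs false

variable {n l : ℕ}
variable {X : Type} [Countable X] [MeasurableSpace X] [DiscreteMeasurableSpace X]
  [TopologicalSpace X] [DiscreteTopology X] [BorelSpace X] [SecondCountableTopology X]
variable {A : Fin n → Type} [∀ i, MeasurableSpace (A i)] [∀ i, TopologicalSpace (A i)]
  [∀ i, PolishSpace (A i)] [∀ i, BorelSpace (A i)]
variable (G : GameData n l X A)

section MarkovFacts

lemma hasSum_int (μ : Measure X) (f : X → ℝ) (hf : Integrable f μ) :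
    HasSum (fun x => μ.real {x} * f x) (∫ x, f x ∂μ) := by
  have h := hasSum_integral_iUnion (f := f) (μ := μ) (s := fun x : X => ({x} : Set X))
    (fun x => measurableSet_singleton x)
    (fun x y hxy => by simpa [Function.onFun] using hxy) hf.integrableOn
  simp only [integral_singleton, Set.iUnion_of_singleton, Measure.restrict_univ,
    smul_eq_mul] at h
  exact h

lemma hasSum_lint (μ : Measure X) (f : X → ℝ≥0∞) (hf : ∫⁻ x, f x ∂μ ≠ ⊤) :
    HasSum (fun x => μ.real {x} * (f x).toReal) (∫⁻ x, f x ∂μ).toReal := by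
  rw [lintegral_countable'] at hf ⊢
  have h := (ENNReal.summable_toReal hf).hasSum
  rw [← ENNReal.tsum_toReal_eq (fun x => ENNReal.ne_top_of_tsum_ne_top hf x)] at h
  refine h.congr_fun ?_
  intro x
  rw [ENNReal.toReal_mul, mul_comm]; rfl

/-- State law as real numbers. -/
noncomputable def D (π : MultiStrategy G) (t : ℕ) (x : X) : ℝ := (slw G π t).real {x}

/-- Real transition probabilities under a stationary profile. -/
noncomputable def pr (φ : StatProfile G) (x y : X) : ℝ := ∫ a, (G.p x a).real {y} ∂(sj G φ x)

/-- Expected one-stage cost under a stationary profile. -/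
noncomputable def cr (f : X → JA A → ℝ) (φ : StatProfile G) (x : X) : ℝ := ∫ a, f x a ∂(sj G φ x)

lemma D_nonneg (π : MultiStrategy G) (t : ℕ) (x : X) : 0 ≤ D G π t x := measureReal_nonneg

lemma D_sum (π : MultiStrategy G) (t : ℕ) : HasSum (D G π t) 1 := by
  have := hasSum_int (slw G π t) (fun _ => 1) (integrable_const _)
  simp only [mul_one, integral_const, probReal_univ, smul_eq_mul] at this
  exact this

lemma pr_nonneg (φ : StatProfile G) (x y : X) : 0 ≤ pr G φ x y :=
  integral_nonneg fun _ => measureReal_nonneg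

lemma p_meas (x y : X) : Measurable fun a => (G.p x a).real {y} := (G.hpm x y).ennreal_toReal

lemma p_le_one (x y : X) (a : JA A) : (G.p x a).real {y} ≤ 1 := by
  haveI := G.hp x a
  exact measureReal_le_one

lemma p_int (μ : Measure (JA A)) [IsProbabilityMeasure μ] (x y : X) :
    Integrable (fun a => (G.p x a).real {y}) μ :=
  Integrable.of_bound (p_meas G x y).aestronglyMeasurable 1 (Eventually.of_forall fun a => by
    rw [Real.norm_eq_abs, abs_of_nonneg measureReal_nonneg]; exact p_le_one G x y a)

lemma p_sum_le (x : X) (a : JA A) (F : Finset X) : ∑ y ∈ F, (G.p x a).real {y} ≤ 1 := by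
  haveI := G.hp x a
  rw [sum_measureReal_singleton]
  exact measureReal_le_one

lemma pr_sum_le (φ : StatProfile G) (x : X) (F : Finset X) : ∑ y ∈ F, pr G φ x y ≤ 1 := by
  unfold pr
  rw [← integral_finsetSum _ fun y _ => p_int G _ x y]
  calc _ ≤ ∫ a, (1 : ℝ) ∂(sj G φ x) := integral_mono
        (integrable_finsetSum _ fun y _ => p_int G _ x y) (integrable_const _)
        fun a => p_sum_le G x a F
    _ = 1 := by simp

lemma D_succ (τ : ℕ → StatProfile G) (t : ℕ) (y : X) :
    HasSum (fun x => D G (ofMarkov G τ) t x * pr G (τ t) x y) (D G (ofMarkov G τ) (t + 1) y) := by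
  have h := slw_succ_markov G τ t y
  have hne : ∫⁻ x, ∫⁻ a, G.p x a {y} ∂(sj G (τ t) x) ∂(slw G (ofMarkov G τ) t) ≠ ⊤ := by
    rw [← h]; exact measure_ne_top _ _
  have h2 := hasSum_lint _ _ hne
  rw [← h] at h2
  refine h2.congr_fun ?_
  intro x
  unfold D pr
  congr 1
  exact integral_toReal (G.hpm x y).aemeasurable (Eventually.of_forall fun a => by
    haveI := G.hp x a; exact measure_lt_top _ _)

lemma kl_le_D (τ : ℕ → StatProfile G) (S : Finset X) (t : ℕ) (y : X) :
    kl (fun x => G.η.real {x}) (fun t => pr G (τ t)) S t y ≤ D G (ofMarkov G τ) t y := by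
  induction t generalizing y with
  | zero =>
    simp only [kl]
    split_ifs
    · simp [D, slw_zero]
    · exact D_nonneg ..
  | succ t ih =>
    simp only [kl]
    split_ifs
    · refine le_trans (Finset.sum_le_sum fun x _ => ?_) (sum_le_hasSum S
        (fun x _ => mul_nonneg (D_nonneg ..) (pr_nonneg ..)) (D_succ G τ t y))
      exact mul_le_mul_of_nonneg_right (ih x) (pr_nonneg ..)
    · exact D_nonneg ..

variable {w : X → ℝ}

lemma B_int (hB : AssumptionB G w) (π : MultiStrategy G) (t : ℕ) :
    Integrable w (slw G π t) := by
  obtain ⟨hw1, _, _, h4⟩ := hB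
  have h := (h4 t).eventually (gt_mem_nhds (show (0 : ℝ≥0∞) < 1 by norm_num))
  obtain ⟨k, hk⟩ := h.exists
  have hk2 := (le_iSup (fun π : MultiStrategy G =>
      ∫⁻ h in {h | (k : ℝ) ≤ w (lastState X (JA A) t h)},
        ENNReal.ofReal (w (lastState X (JA A) t h)) ∂(histMeas G G.η π t)) π).trans hk.le
  refine ⟨(Measurable.of_discrete).aestronglyMeasurable, ?_⟩
  rw [hasFiniteIntegral_iff_ofReal (Eventually.of_forall fun x => by
    exact (zero_le_one.trans (hw1 x)))]
  have hms : MeasurableSet {x : X | (k : ℝ) ≤ w x} := MeasurableSet.of_discrete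
  rw [← lintegral_add_compl _ hms]
  have e1 : ∫⁻ x in {x : X | (k : ℝ) ≤ w x}, ENNReal.ofReal (w x) ∂(slw G π t) ≤ 1 := by
    rw [slw, setLIntegral_map hms Measurable.of_discrete (measurable_lastState X (JA A) t)]
    exact hk2
  have e2 : ∫⁻ x in {x : X | (k : ℝ) ≤ w x}ᶜ, ENNReal.ofReal (w x) ∂(slw G π t) ≤
      ENNReal.ofReal k := by
    calc _ ≤ ∫⁻ x in {x : X | (k : ℝ) ≤ w x}ᶜ, ENNReal.ofReal k ∂(slw G π t) := by
          refine setLIntegral_mono' hms.compl fun x hx => ?_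
          exact ENNReal.ofReal_le_ofReal (not_le.1 (show ¬ (k : ℝ) ≤ w x from hx)).le
      _ ≤ ENNReal.ofReal k := by
          rw [setLIntegral_const]
          exact mul_le_of_le_one_right' prob_le_one
  exact (add_le_add e1 e2).trans_lt (by simp)

lemma B_sum (hB : AssumptionB G w) (π : MultiStrategy G) (t : ℕ) :
    HasSum (fun x => D G π t x * w x) (wStateExp G G.η π t w).toReal ∧
      wStateExp G G.η π t w ≠ ⊤ := by
  have h0 : ∀ x, 0 ≤ w x := fun x => zero_le_one.trans (hB.1 x)
  have h1 := (B_int G hB π t).2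
  rw [hasFiniteIntegral_iff_ofReal (Eventually.of_forall h0)] at h1
  rw [wStateExp_eq]
  refine ⟨?_, h1.ne⟩
  have h2 := hasSum_lint _ _ h1.ne
  refine h2.congr_fun ?_
  intro x
  rw [ENNReal.toReal_ofReal (h0 x)]; rfl

lemma B_UI (hB : AssumptionB G w) (t : ℕ) (ε : ℝ) (hε : 0 < ε) :
    ∃ Q : ℝ, 0 ≤ Q ∧ ∀ π : MultiStrategy G,
      ∑' x, (if Q ≤ w x then D G π t x * w x else 0) ≤ ε := by
  have h0 : ∀ x, 0 ≤ w x := fun x => zero_le_one.trans (hB.1 x)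
  have h := (hB.2.2.2 t).eventually (gt_mem_nhds (ENNReal.ofReal_pos.2 hε))
  obtain ⟨k, hk⟩ := h.exists
  refine ⟨k, k.cast_nonneg, fun π => ?_⟩
  have hk2 := (le_iSup (fun π : MultiStrategy G =>
      ∫⁻ h in {h | (k : ℝ) ≤ w (lastState X (JA A) t h)},
        ENNReal.ofReal (w (lastState X (JA A) t h)) ∂(histMeas G G.η π t)) π).trans hk.le
  have hms : MeasurableSet {x : X | (k : ℝ) ≤ w x} := MeasurableSet.of_discrete
  have e1 : ∫⁻ x, ({x : X | (k : ℝ) ≤ w x}.indicator fun x => ENNReal.ofReal (w x)) x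
      ∂(slw G π t) ≤ ENNReal.ofReal ε := by
    rw [lintegral_indicator hms, slw,
      setLIntegral_map hms Measurable.of_discrete (measurable_lastState X (JA A) t)]
    exact hk2
  have h2 := hasSum_lint _ _ (e1.trans_lt ENNReal.ofReal_lt_top).ne
  have e3 : ∑' x, (if (k : ℝ) ≤ w x then D G π t x * w x else 0) =
      (∫⁻ x, ({x : X | (k : ℝ) ≤ w x}.indicator fun x => ENNReal.ofReal (w x)) x
        ∂(slw G π t)).toReal := by
    rw [← h2.tsum_eq]
    refine tsum_congr fun x => ?_
    by_cases hx : (k : ℝ) ≤ w x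
    · simp [hx, ENNReal.toReal_ofReal (h0 x), D]
    · simp [hx]
  rw [e3]
  exact ENNReal.toReal_le_of_le_ofReal hε.le e1

lemma B_tail (hB : AssumptionB G w) (ε : ℝ) (hε : 0 < ε) :
    ∃ T : ℕ, ∀ π : MultiStrategy G, (Summable fun t => G.α ^ t * ∑' x, D G π t x * w x) ∧
      ∑' t, (if T ≤ t then G.α ^ t * ∑' x, D G π t x * w x else 0) ≤ ε := by
  have hα : 0 < 1 - G.α := sub_pos.2 G.hα1
  have h := hB.2.2.1.eventually (gt_mem_nhds (ENNReal.ofReal_pos.2 (mul_pos hα hε)))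
  obtain ⟨k, hk⟩ := h.exists
  refine ⟨k, fun π => ?_⟩
  have hk2 := (le_iSup (fun π : MultiStrategy G => ENNReal.ofReal (1 - G.α) *
        ∑' t : ℕ, ENNReal.ofReal G.α ^ (k + t) * wStateExp G G.η π (k + t) w) π).trans hk.le
  rw [ENNReal.ofReal_mul hα.le, ENNReal.mul_le_mul_iff_right (by simpa using G.hα1)
    ENNReal.ofReal_ne_top] at hk2
  have hne := (hk2.trans_lt ENNReal.ofReal_lt_top).ne
  have h1 := (ENNReal.summable_toReal hne).hasSum
  rw [← ENNReal.tsum_toReal_eq (fun x => ENNReal.ne_top_of_tsum_ne_top hne x)] at h1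
  have e1 : (fun t => (ENNReal.ofReal G.α ^ (k + t) * wStateExp G G.η π (k + t) w).toReal) =
      fun t => G.α ^ (t + k) * ∑' x, D G π (t + k) x * w x := by
    funext t
    rw [ENNReal.toReal_mul, ENNReal.toReal_pow, ENNReal.toReal_ofReal G.hα0.le,
      (B_sum G hB π (t + k)).1.tsum_eq, add_comm k t]
  rw [e1] at h1
  have hs := (summable_nat_add_iff (f := fun t => G.α ^ t * ∑' x, D G π t x * w x) k).1 h1.summable
  refine ⟨hs, ?_⟩
  have hs2 : Summable fun t => if k ≤ t then G.α ^ t * ∑' x, D G π t x * w x else 0 := by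
    refine (summable_nat_add_iff k).1 ?_
    simpa using h1.summable
  rw [← hs2.sum_add_tsum_nat_add k, Finset.sum_eq_zero fun t ht => by
    simp [Finset.mem_range.1 ht]]
  simp only [zero_add, Nat.le_add_left, if_true]
  rw [h1.tsum_eq]
  exact ENNReal.toReal_le_of_le_ofReal hε.le hk2

lemma cr_le (f : X → JA A → ℝ) (φ : StatProfile G)
    (hfw : ∀ x a, a ∈ jointSet G x → |f x a| ≤ w x) (x : X) : |cr G f φ x| ≤ w x := by
  have := norm_integral_le_of_norm_le_const (μ := sj G φ x) (C := w x)
      (f := fun b => f x b) (by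
        filter_upwards [sj_ae G φ x] with b hb using hfw x _ hb)
  simpa [cr] using this

lemma Jfun_markov (hB : AssumptionB G w) (τ : ℕ → StatProfile G) (f : X → JA A → ℝ)
    (hfw : ∀ x a, a ∈ jointSet G x → |f x a| ≤ w x) :
    (∀ t, Summable fun x => D G (ofMarkov G τ) t x * cr G f (τ t) x) ∧
    (Summable fun t => G.α ^ t * ∑' x, D G (ofMarkov G τ) t x * cr G f (τ t) x) ∧
    Jfun G G.η f (ofMarkov G τ) =
      (1 - G.α) * ∑' t, G.α ^ t * ∑' x, D G (ofMarkov G τ) t x * cr G f (τ t) x := by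
  have hI : ∀ t, Integrable (fun x => cr G f (τ t) x) (slw G (ofMarkov G τ) t) := fun t =>
    (B_int G hB (ofMarkov G τ) t).mono' (Measurable.of_discrete).aestronglyMeasurable
      (Eventually.of_forall fun x => cr_le G f (τ t) hfw x)
  have hS := fun t => hasSum_int _ _ (hI t)
  refine ⟨fun t => (hS t).summable, ?_, ?_⟩
  · obtain ⟨T, hT⟩ := B_tail G hB 1 one_pos
    refine Summable.of_norm_bounded (hT (ofMarkov G τ)).1 fun t => ?_
    rw [Real.norm_eq_abs, abs_mul, abs_of_nonneg (pow_nonneg G.hα0.le t)]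
    refine mul_le_mul_of_nonneg_left ?_ (pow_nonneg G.hα0.le t)
    rw [← Real.norm_eq_abs]
    refine tsum_of_norm_bounded (B_sum G hB (ofMarkov G τ) t).1.summable.hasSum fun x => ?_
    rw [Real.norm_eq_abs, abs_mul, abs_of_nonneg (D_nonneg ..)]
    exact mul_le_mul_of_nonneg_left (cr_le G f (τ t) hfw x) (D_nonneg ..)
  · unfold Jfun
    congr 1
    refine tsum_congr fun t => ?_
    congr 1
    rw [stageExp_markov]
    exact (hS t).tsum_eq.symm

end MarkovFacts

end CSGame

open MeasureTheory ProbabilityTheory Filter Topology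
open scoped ENNReal NNReal

namespace CSGame

set_option linter.unusedSectionVars false
set_option linter.style.haveILetI false
set_option linter.unusedSimpArgs false

variable {n l : ℕ}
variable {X : Type} [Countable X] [MeasurableSpace X] [DiscreteMeasurableSpace X]
  [TopologicalSpace X] [DiscreteTopology X] [BorelSpace X] [SecondCountableTopology X]
variable {A : Fin n → Type} [∀ i, MeasurableSpace (A i)] [∀ i, TopologicalSpace (A i)]
  [∀ i, PolishSpace (A i)] [∀ i, BorelSpace (A i)]
variable (G : GameData n l X A)

section WeakConv

lemma exists_tietze (x : X) (f : JA A → ℝ) (hf : ContinuousOn f (jointSet G x)) :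
    ∃ g : BoundedContinuousFunction (JA A) ℝ, ∀ a ∈ jointSet G x, g a = f a := by
  haveI : CompactSpace (jointSet G x) := isCompact_iff_compactSpace.1 (isCompact_jointSet G x)
  letI : ∀ i, MetricSpace (A i) := fun i => TopologicalSpace.metrizableSpaceMetric (A i)
  let F : BoundedContinuousFunction (jointSet G x) ℝ := BoundedContinuousFunction.mkOfCompact
    ⟨(jointSet G x).restrict f, hf.restrict⟩
  obtain ⟨g, _, hg⟩ := BoundedContinuousFunction.exists_extension_norm_eq_of_isClosedEmbedding F
    (isCompact_jointSet G x).isClosed.isClosedEmbedding_subtypeVal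
  refine ⟨g, fun a ha => ?_⟩
  have := congrFun hg ⟨a, ha⟩
  exact this

theorem sj_conv {M : Type*} (u : Filter M) (τm : M → StatProfile G) (τ : StatProfile G) (x : X)
    (hτ : ∀ i, Tendsto (fun m => (τm m i).1 x) u (𝓝 ((τ i).1 x))) (f : JA A → ℝ)
    (hf : ContinuousOn f (jointSet G x)) :
    Tendsto (fun m => ∫ a, f a ∂(sj G (τm m) x)) u (𝓝 (∫ a, f a ∂(sj G τ x))) := by
  obtain ⟨g, hg⟩ := exists_tietze G x f hf
  have e : ∀ φ : StatProfile G, ∫ a, f a ∂(sj G φ x) = ∫ a, g a ∂(sj G φ x) := fun φ =>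
    integral_congr_ae (by filter_upwards [sj_ae G φ x] with a ha using (hg a ha).symm)
  simp only [e]
  have h1 : Tendsto (fun m => ProbabilityMeasure.pi fun i => (τm m i).1 x) u
      (𝓝 (ProbabilityMeasure.pi fun i => (τ i).1 x)) :=
    (ProbabilityMeasure.continuous_pi.tendsto _).comp (tendsto_pi_nhds.2 hτ)
  exact ProbabilityMeasure.tendsto_iff_forall_integral_tendsto.1 h1 g

lemma exists_limit (U : Ultrafilter ℕ) (φm : ℕ → StatProfile G) :
    ∃ φ : StatProfile G, ∀ i x, Tendsto (fun m => (φm m i).1 x) U (𝓝 ((φ i).1 x)) := by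
  have key : ∀ i x, ∃ μ : ProbabilityMeasure (A i), μ (G.As i x) = 1 ∧
      Tendsto (fun m => (φm m i).1 x) U (𝓝 μ) := by
    intro i x
    have hcpt := isCompact_setOfPred_probabilityMeasure_mass_eq_compl_isCompact_le (E := A i)
      (u := fun _ => 0) (K := fun _ => G.As i x) tendsto_const_nhds (fun _ => G.hAs_cpt i x)
      (Or.inr fun _ _ _ => le_rfl)
    have hiff : ∀ μ : ProbabilityMeasure (A i), μ (G.As i x) = 1 ↔ ∀ _ : ℕ, μ (G.As i x)ᶜ ≤ 0 := by
      intro μ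
      have h2 := prob_compl_eq_zero_iff (μ := (μ : Measure (A i))) (measurableSet_As G i x)
      rw [← ProbabilityMeasure.ennreal_coeFn_eq_coeFn_toMeasure,
        ← ProbabilityMeasure.ennreal_coeFn_eq_coeFn_toMeasure] at h2
      norm_cast at h2
      simp [h2]
    obtain ⟨μ, hμ, hle⟩ := hcpt.ultrafilter_le_nhds (U.map fun m => (φm m i).1 x) (by
      refine le_principal_iff.2 ?_
      refine Filter.mem_map.2 (Filter.univ_mem' fun m => ?_)
      exact (hiff _).1 ((φm m i).2 x))
    exact ⟨μ, (hiff μ).2 hμ, hle⟩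
  choose μ h1 h2 using key
  exact ⟨fun i => ⟨μ i, h1 i⟩, h2⟩

variable {w : X → ℝ}

theorem J_conv (hA : AssumptionA G) (hB : AssumptionB G w) {M : Type*} (u : Filter M)
    (τm : M → ℕ → StatProfile G)
    (τ : ℕ → StatProfile G)
    (hτ : ∀ t i x, Tendsto (fun m => (τm m t i).1 x) u (𝓝 ((τ t i).1 x)))
    (Sm : M → Finset X) (hS : ∀ y, ∀ᶠ m in u, y ∈ Sm m)
    (f : X → JA A → ℝ) (hf : ∀ x, ContinuousOn (f x) (jointSet G x))
    (hfw : ∀ x a, a ∈ jointSet G x → |f x a| ≤ w x) :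
    Tendsto (fun m => Jk G.α (fun x => G.η.real {x}) (fun t => pr G (τm m t)) (Sm m)
      (fun t => cr G f (τm m t))) u (𝓝 (Jfun G G.η f (ofMarkov G τ))) := by
  obtain ⟨h1, h2, h3⟩ := Jfun_markov G hB τ f hfw
  rw [h3]
  have hη0 : (fun x => G.η.real {x}) = D G (ofMarkov G τ) 0 := by
    funext x; simp [D, slw_zero]
  refine Jk_conv (η := fun x => G.η.real {x}) (K := fun t => pr G (τ t)) u G.α G.hα0
    (fun x => measureReal_nonneg)
    (by rw [hη0]; exact D_sum G (ofMarkov G τ) 0) (fun m t => pr G (τm m t))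
    (fun m t x y => pr_nonneg ..) (fun m t x F => pr_sum_le ..)
    (fun t x y => sj_conv G u _ _ x (fun i => hτ t i x) _ ?_) Sm hS
    (fun m t => cr G f (τm m t)) (fun t => cr G f (τ t)) w (fun m t x => cr_le G f _ hfw x)
    (fun t x => sj_conv G u _ _ x (fun i => hτ t i x) _ (hf x))
    (fun m => D G (ofMarkov G (τm m))) (fun m t x => kl_le_D G (τm m) (Sm m) t x)
    (fun m t => (B_sum G hB _ t).1.summable)
    (fun t ε hε => ?_) (fun m => ?_) (fun ε hε => ?_) (D G (ofMarkov G τ)) hη0.symm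
    (fun t y => D_succ G τ t y) (fun t => D_sum ..) h1 h2
  · refine ENNReal.continuousOn_toReal.comp (hA.1 x y) fun a _ => ?_
    haveI := G.hp x a
    exact measure_ne_top _ _
  · obtain ⟨Q, hQ, h⟩ := B_UI G hB t ε hε
    exact ⟨Q, hQ, fun m => h _⟩
  · obtain ⟨T, hT⟩ := B_tail G hB 1 one_pos
    exact (hT _).1
  · obtain ⟨T, hT⟩ := B_tail G hB ε hε
    exact ⟨T, fun m => (hT _).2⟩

end WeakConv

end CSGame

open MeasureTheory ProbabilityTheory Filter Topology
open scoped ENNReal NNReal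

namespace CSGame

set_option linter.unusedSectionVars false
set_option linter.style.haveILetI false
set_option linter.unusedSimpArgs false

variable {n l : ℕ}
variable {X : Type} [Countable X] [MeasurableSpace X] [DiscreteMeasurableSpace X]
  [TopologicalSpace X] [DiscreteTopology X] [BorelSpace X] [SecondCountableTopology X]
variable {A : Fin n → Type} [∀ i, MeasurableSpace (A i)] [∀ i, TopologicalSpace (A i)]
  [∀ i, PolishSpace (A i)] [∀ i, BorelSpace (A i)]
variable (G : GameData n l X A)

section Level

variable {w : X → ℝ}

/-- One-step cost-to-go in the game killed outside the finite set `S`. -/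
noncomputable def tt (S : Finset X) (i : Fin n) (ℓ : Fin (l + 1)) (x : X) (b : JA A)
    (V : S → ℝ) : ℝ :=
  (1 - G.α) * G.c i ℓ x b + G.α * ∑ y : S, (G.p x b).real {(y : X)} * V y

/-- Penalty multipliers. -/
noncomputable def lm (k : ℝ) (i : Fin n) (ℓ : Fin (l + 1)) (v : ℝ) : ℝ :=
  if ℓ = 0 then 1 else k * max (v - G.κ i ℓ) 0

/-- The killed discounted cost of a Markov profile. -/
noncomputable def JS (S : Finset X) (i : Fin n) (ℓ : Fin (l + 1)) (τ : ℕ → StatProfile G) : ℝ :=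
  Jk G.α (fun x => G.η.real {x}) (fun t => pr G (τ t)) S (fun t => cr G (G.c i ℓ) (τ t))

lemma lm_nonneg (k : ℝ) (hk : 0 ≤ k) (i : Fin n) (ℓ : Fin (l + 1)) (v : ℝ) :
    0 ≤ lm G k i ℓ v := by
  unfold lm; split_ifs
  · exact zero_le_one
  · positivity

lemma lm_cont (k : ℝ) (i : Fin n) (ℓ : Fin (l + 1)) : Continuous (lm G k i ℓ) := by
  unfold lm; split_ifs
  · exact continuous_const
  · fun_prop

lemma p_contOn (hA : AssumptionA G) (x y : X) :
    ContinuousOn (fun a => (G.p x a).real {y}) (jointSet G x) := by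
  refine ENNReal.continuousOn_toReal.comp (hA.1 x y) fun a _ => ?_
  haveI := G.hp x a
  exact measure_ne_top _ _

lemma tt_meas (S : Finset X) (i : Fin n) (ℓ : Fin (l + 1)) (x : X) (V : S → ℝ) :
    Measurable fun b => tt G S i ℓ x b V := by
  unfold tt
  refine ((G.hc i ℓ x).const_mul _).add (Measurable.const_mul ?_ _)
  exact Finset.measurable_fun_sum (Finset.univ : Finset S) fun y _ =>
    (p_meas G x (y : X)).mul_const (V y)

lemma c_int (hB : AssumptionB G w) (τ : StatProfile G) (i : Fin n) (ℓ : Fin (l + 1)) (x : X) :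
    Integrable (G.c i ℓ x) (sj G τ x) :=
  bound_integrable G x _ (fun j => stat_supp G j (τ j) x) _ (G.hc i ℓ x) (w x) (hB.2.1 i ℓ x)

lemma tt_integral (hB : AssumptionB G w) (S : Finset X) (i : Fin n) (ℓ : Fin (l + 1)) (x : X)
    (V : S → ℝ) (τ : StatProfile G) :
    Integrable (fun b => tt G S i ℓ x b V) (sj G τ x) ∧
    ∫ b, tt G S i ℓ x b V ∂(sj G τ x) =
      (1 - G.α) * cr G (G.c i ℓ) τ x + G.α * ∑ y : S, pr G τ x y * V y := by
  have h1 := (c_int G hB τ i ℓ x).const_mul (1 - G.α)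
  have h2 : ∀ y ∈ (Finset.univ : Finset S), Integrable
      (fun b => (G.p x b).real {(y : X)} * V y) (sj G τ x) := fun y _ =>
    (p_int G (sj G τ x) x y).mul_const (V y)
  have h3 := (integrable_finsetSum _ h2).const_mul G.α
  refine ⟨h1.add h3, ?_⟩
  unfold tt
  rw [integral_add h1 h3, integral_const_mul, integral_const_mul, integral_finsetSum _ h2]
  congr 2
  exact Finset.sum_congr rfl fun y _ => integral_mul_const _ _

theorem level (hA : AssumptionA G) (hB : AssumptionB G w) (S : Finset X) (k : ℝ) (hk : 0 ≤ k)
    (ε : ℝ) (hε : 0 < ε) :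
    ∃ φ : StatProfile G, ∀ i (ψ : ℕ → Stat G i),
      ∑ ℓ, lm G k i ℓ (JS G S i ℓ fun _ => φ) * JS G S i ℓ (fun _ => φ) ≤
      ∑ ℓ, lm G k i ℓ (JS G S i ℓ fun _ => φ) *
        JS G S i ℓ (fun t => Function.update φ i (ψ t)) + ε / (1 - G.α) := by
  classical
  have hα0 := G.hα0
  have hα1 := G.hα1
  have hw0 : ∀ x, 0 ≤ w x := fun x => zero_le_one.trans (hB.1 x)
  haveI := G.hη
  set C : ℝ := ∑ x ∈ S, w x with hCdef
  have hC : 0 ≤ C := Finset.sum_nonneg fun x _ => hw0 x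
  have hwC : ∀ x ∈ S, w x ≤ C := fun x hx => Finset.single_le_sum (fun x _ => hw0 x) hx
  let R := Fin n × Fin (l + 1) × S
  let vw : Fin n → Fin (l + 1) → (R → ℝ) → S → ℝ := fun i ℓ W y => W (i, ℓ, y)
  let lam : Fin n → Fin (l + 1) → (R → ℝ) → ℝ := fun i ℓ W =>
    lm G k i ℓ (∑ x : S, G.η.real {(x : X)} * W (i, ℓ, x))
  have hlamc : ∀ i ℓ, Continuous (lam i ℓ) := fun i ℓ => (lm_cont G k i ℓ).comp (by fun_prop)
  obtain ⟨φ, W, hW, hWeq, hbr⟩ := approx_eq G S (R := R) (fun r => r.2.2)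
    (fun r b W => tt G S r.1 r.2.1 r.2.2 b (vw r.1 r.2.1 W))
    (fun i x b W => ∑ ℓ, lam i ℓ W * tt G S i ℓ x b (vw i ℓ W)) C hC
    (fun r b => by simp only [tt, vw]; fun_prop)
    (fun i x W => Finset.measurable_fun_sum _ fun ℓ _ => (tt_meas G S i ℓ x _).const_mul _)
    (fun i x => by
      refine continuousOn_finsetSum _ fun ℓ _ => ?_
      refine ((hlamc i ℓ).comp continuous_snd).continuousOn.mul ?_
      have hfst : Set.MapsTo (Prod.fst : JA A × (R → ℝ) → JA A)
        (jointSet G x ×ˢ Set.univ) (jointSet G x) := fun z hz => hz.1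
      simp only [tt, vw]
      refine ContinuousOn.add (continuousOn_const.mul
        ((hA.2 i ℓ x).comp continuous_fst.continuousOn hfst)) (continuousOn_const.mul ?_)
      refine continuousOn_finsetSum _ fun y _ => ?_
      exact ((p_contOn G hA x y).comp continuous_fst.continuousOn hfst).mul
        (by fun_prop))
    (fun r b hb W hW => by
      have e1 : |G.c r.1 r.2.1 r.2.2 b| ≤ C := (hB.2.1 _ _ _ _ hb).trans (hwC _ r.2.2.2)
      have e2 : |∑ y : S, (G.p r.2.2 b).real {(y : X)} * W (r.1, r.2.1, y)| ≤ C := by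
        calc _ ≤ ∑ y : S, |(G.p r.2.2 b).real {(y : X)} * W (r.1, r.2.1, y)| :=
              Finset.abs_sum_le_sum_abs _ _
          _ ≤ ∑ y : S, (G.p r.2.2 b).real {(y : X)} * C := Finset.sum_le_sum fun y _ => by
              rw [abs_mul, abs_of_nonneg measureReal_nonneg]
              exact mul_le_mul_of_nonneg_left (hW _) measureReal_nonneg
          _ ≤ C := by
              rw [← Finset.sum_mul, Finset.sum_coe_sort S (fun y => (G.p r.2.2 b).real {y})]
              nlinarith [p_sum_le G r.2.2 b S]
      simp only [tt, vw]
      rw [abs_le] at e1 e2 ⊢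
      constructor <;> nlinarith [e1.1, e1.2, e2.1, e2.2]) ε hε
  refine ⟨φ, fun i ψ => ?_⟩
  have hηsum : ∑ x ∈ S, G.η.real {x} ≤ 1 := by
    rw [sum_measureReal_singleton]; exact measureReal_le_one
  let V : Fin (l + 1) → X → ℝ := fun ℓ x => if h : x ∈ S then W (i, ℓ, ⟨x, h⟩) else 0
  have hVS : ∀ ℓ (y : S), V ℓ y = W (i, ℓ, y) := fun ℓ y => by simp [V]
  have hsumS : ∀ ℓ (q : X → ℝ), ∑ y : S, q y * W (i, ℓ, y) = ∑ y ∈ S, q y * V ℓ y := by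
    intro ℓ q
    rw [← Finset.sum_coe_sort S]
    exact Finset.sum_congr rfl fun y _ => by rw [hVS]
  have hJ : ∀ ℓ, ∑ x ∈ S, G.η.real {x} * V ℓ x = JS G S i ℓ fun _ => φ := by
    intro ℓ
    refine kl_verify_eq (fun x => G.η.real {x}) (fun _ => pr G φ) S G.α hα0 hα1
      (fun x => measureReal_nonneg) hηsum (fun _ x y => pr_nonneg ..)
      (fun _ x => pr_sum_le ..) (fun _ => cr G (G.c i ℓ) φ) (V ℓ) C hC
      (fun _ x hx => (cr_le G _ _ (hB.2.1 i ℓ) x).trans (hwC x hx)) (fun _ x hx => ?_)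
    have h := hWeq (i, ℓ, ⟨x, hx⟩)
    rw [(tt_integral G hB S i ℓ x _ φ).2] at h
    rw [← hsumS, ← h]
    exact hVS ℓ ⟨x, hx⟩
  have hlam : ∀ ℓ, lam i ℓ W = lm G k i ℓ (JS G S i ℓ fun _ => φ) := by
    intro ℓ
    simp only [lam]
    rw [hsumS ℓ (fun x => G.η.real {x}), hJ]
  set q : Fin (l + 1) → ℝ := fun ℓ => lam i ℓ W with hq
  have hhint : ∀ (τ : StatProfile G) (x : X),
      Integrable (fun b => ∑ ℓ, q ℓ * tt G S i ℓ x b (vw i ℓ W)) (sj G τ x) ∧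
      ∫ b, ∑ ℓ, q ℓ * tt G S i ℓ x b (vw i ℓ W) ∂(sj G τ x) =
        ∑ ℓ, q ℓ * ((1 - G.α) * cr G (G.c i ℓ) τ x + G.α * ∑ y ∈ S, pr G τ x y * V ℓ y) := by
    intro τ x
    have h0 : ∀ ℓ ∈ (Finset.univ : Finset (Fin (l + 1))), Integrable
        (fun b => q ℓ * tt G S i ℓ x b (vw i ℓ W)) (sj G τ x) := fun ℓ _ =>
      (tt_integral G hB S i ℓ x _ τ).1.const_mul _
    refine ⟨integrable_finsetSum _ h0, ?_⟩
    rw [integral_finsetSum _ h0]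
    refine Finset.sum_congr rfl fun ℓ _ => ?_
    rw [integral_const_mul, (tt_integral G hB S i ℓ x _ τ).2, ← hsumS]
  have hmeas : ∀ x, Measurable fun b => ∑ ℓ, q ℓ * tt G S i ℓ x b (vw i ℓ W) := fun x =>
    Finset.measurable_fun_sum _ fun ℓ _ => (tt_meas G S i ℓ x _).const_mul _
  have hmain : ∀ t, ∀ x ∈ S, ∑ ℓ, q ℓ * V ℓ x ≤
      (1 - G.α) * (∑ ℓ, q ℓ * cr G (G.c i ℓ) (Function.update φ i (ψ t)) x) +
      G.α * ∑ y ∈ S, pr G (Function.update φ i (ψ t)) x y * (∑ ℓ, q ℓ * V ℓ y) + ε := by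
    intro t x hx
    have hA1 := hbr i ⟨x, hx⟩
    have e0 : ∑ ℓ, q ℓ * V ℓ x = ∫ b, ∑ ℓ, q ℓ * tt G S i ℓ x b (vw i ℓ W) ∂(sj G φ x) := by
      rw [integral_finsetSum _ fun ℓ _ => (tt_integral G hB S i ℓ x _ φ).1.const_mul _]
      refine Finset.sum_congr rfl fun ℓ _ => ?_
      rw [integral_const_mul]
      have h := hWeq (i, ℓ, ⟨x, hx⟩)
      simp only at h
      rw [← h]
      congr 1
      exact hVS ℓ ⟨x, hx⟩
    obtain ⟨h1, h2⟩ := integral_pi_update (fun j => sl G (φ j) x) i (sl G (ψ t) x) _ (hmeas x)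
      (by rw [← sj_update]; exact (hhint (Function.update φ i (ψ t)) x).1)
    rw [← sj_update, (hhint _ x).2] at h2
    have h3 : ∫ b, ∑ ℓ, q ℓ * tt G S i ℓ x b (vw i ℓ W) ∂(sj G φ x) - ε ≤
        ∫ a, ∫ b, ∑ ℓ, q ℓ * tt G S i ℓ x (Function.update b i a) (vw i ℓ W)
          ∂(Measure.pi fun j => sl G (φ j) x) ∂(sl G (ψ t) x) := by
      have hae : ∀ᵐ a ∂(sl G (ψ t) x), a ∈ G.As i x :=
        (mem_ae_iff_prob_eq_one (measurableSet_As G i x)).2 (stat_supp G i (ψ t) x)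
      have := integral_mono_ae (μ := sl G (ψ t) x) (integrable_const
        (∫ b, ∑ ℓ, q ℓ * tt G S i ℓ x b (vw i ℓ W) ∂(sj G φ x) - ε)) h1 (by
          filter_upwards [hae] with a ha
          have := hA1 a ha
          exact sub_le_iff_le_add.2 this)
      simpa using this
    rw [← h2, ← e0] at h3
    have e5 : ∑ ℓ, q ℓ * ((1 - G.α) * cr G (G.c i ℓ) (Function.update φ i (ψ t)) x +
        G.α * ∑ y ∈ S, pr G (Function.update φ i (ψ t)) x y * V ℓ y) =
      (1 - G.α) * (∑ ℓ, q ℓ * cr G (G.c i ℓ) (Function.update φ i (ψ t)) x) +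
      G.α * ∑ y ∈ S, pr G (Function.update φ i (ψ t)) x y * (∑ ℓ, q ℓ * V ℓ y) := by
      simp only [Finset.mul_sum, mul_add, Finset.sum_add_distrib]
      congr 1
      · exact Finset.sum_congr rfl fun ℓ _ => by ring
      · rw [Finset.sum_comm]
        exact Finset.sum_congr rfl fun y _ => Finset.sum_congr rfl fun ℓ _ => by ring
    rw [e5] at h3
    linarith
  set C2 : ℝ := ∑ ℓ, |q ℓ| * C with hC2
  have hver := kl_verify (fun x => G.η.real {x}) (fun t => pr G (Function.update φ i (ψ t))) S
    G.α hα0 hα1 (fun x => measureReal_nonneg) hηsum (fun _ x y => pr_nonneg ..)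
    (fun _ x => pr_sum_le ..)
    (fun t x => ∑ ℓ, q ℓ * cr G (G.c i ℓ) (Function.update φ i (ψ t)) x)
    (fun x => ∑ ℓ, q ℓ * V ℓ x) ε hε.le C2
    (Finset.sum_nonneg fun ℓ _ => mul_nonneg (abs_nonneg _) hC)
    (fun t x hx => (Finset.abs_sum_le_sum_abs _ _).trans (Finset.sum_le_sum fun ℓ _ => by
      rw [abs_mul]
      exact mul_le_mul_of_nonneg_left ((cr_le G _ _ (hB.2.1 i ℓ) x).trans (hwC x hx))
        (abs_nonneg _))) hmain
  rw [Jk_lin (fun x => G.η.real {x}) (fun t => pr G (Function.update φ i (ψ t))) S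
    G.α hα0 hα1 (fun x => measureReal_nonneg) hηsum (fun _ x y => pr_nonneg ..)
    (fun _ x => pr_sum_le ..) Finset.univ q
    (fun ℓ t x => cr G (G.c i ℓ) (Function.update φ i (ψ t)) x) C hC
    (fun ℓ t x hx => (cr_le G _ _ (hB.2.1 i ℓ) x).trans (hwC x hx))] at hver
  have e6 : ∑ x ∈ S, G.η.real {x} * ∑ ℓ, q ℓ * V ℓ x =
      ∑ ℓ, q ℓ * JS G S i ℓ (fun _ => φ) := by
    simp only [← hJ, Finset.mul_sum]
    rw [Finset.sum_comm]
    exact Finset.sum_congr rfl fun y _ => Finset.sum_congr rfl fun ℓ _ => by ring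
  rw [e6] at hver
  simp only [← hlam]
  exact hver

end Level

end CSGame

open MeasureTheory ProbabilityTheory Filter Topology
open scoped ENNReal NNReal

namespace CSGame

set_option linter.unusedSectionVars false
set_option linter.style.haveILetI false
set_option linter.unusedSimpArgs false

variable {n l : ℕ}
variable {X : Type} [Countable X] [MeasurableSpace X] [DiscreteMeasurableSpace X]
  [TopologicalSpace X] [DiscreteTopology X] [BorelSpace X] [SecondCountableTopology X]
variable {A : Fin n → Type} [∀ i, MeasurableSpace (A i)] [∀ i, TopologicalSpace (A i)]
  [∀ i, PolishSpace (A i)] [∀ i, BorelSpace (A i)]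
variable (G : GameData n l X A)

section Final

lemma final_real (u : Filter ℕ) [NeBot u] (hu : u ≤ atTop) (κ : Fin (l + 1) → ℝ)
    (am : ℕ → Fin (l + 1) → ℝ) (a : Fin (l + 1) → ℝ)
    (ha : ∀ ℓ, Tendsto (fun m => am m ℓ) u (𝓝 (a ℓ)))
    (lam : ℕ → Fin (l + 1) → ℝ) (h0 : ∀ m, lam m 0 = 1)
    (hl : ∀ m (j : Fin l), lam m j.succ = m * max (am m j.succ - κ j.succ) 0)
    (e : ℕ → ℝ) (he : Tendsto e u (𝓝 0))
    (sm : ℕ → Fin (l + 1) → ℝ) (s : Fin (l + 1) → ℝ)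
    (hs : ∀ ℓ, Tendsto (fun m => sm m ℓ) u (𝓝 (s ℓ)))
    (hsl : ∀ j : Fin l, s j.succ < κ j.succ)
    (hsi : ∀ m, ∑ ℓ, lam m ℓ * am m ℓ ≤ ∑ ℓ, lam m ℓ * sm m ℓ + e m) :
    (∀ j : Fin l, a j.succ ≤ κ j.succ) ∧
    ∀ (bm : ℕ → Fin (l + 1) → ℝ) (b : Fin (l + 1) → ℝ),
      (∀ ℓ, Tendsto (fun m => bm m ℓ) u (𝓝 (b ℓ))) →
      (∀ m, ∑ ℓ, lam m ℓ * am m ℓ ≤ ∑ ℓ, lam m ℓ * bm m ℓ + e m) →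
      (∀ j : Fin l, b j.succ ≤ κ j.succ) → a 0 ≤ b 0 := by
  have hlam0 : ∀ m (j : Fin l), 0 ≤ lam m j.succ := fun m j => by rw [hl]; positivity
  have hlamk : ∀ m (j : Fin l), lam m j.succ * κ j.succ ≤ lam m j.succ * am m j.succ := by
    intro m j
    rcases le_or_gt (am m j.succ) (κ j.succ) with h | h
    · have : lam m j.succ = 0 := by rw [hl, max_eq_right (by linarith), mul_zero]
      simp [this]
    · exact mul_le_mul_of_nonneg_left h.le (hlam0 m j)
  have hB : ∀ j : Fin l, ∃ B : ℝ, ∀ᶠ m in u, lam m j.succ ≤ B := by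
    intro j
    set γ := (κ j.succ - s j.succ) / 2 with hγ
    have hγ0 : 0 < γ := by have := hsl j; simp only [hγ]; linarith
    refine ⟨(s 0 - a 0 + 1) / γ, ?_⟩
    have hd : Tendsto (fun m => e m + sm m 0 - am m 0) u (𝓝 (s 0 - a 0)) := by
      simpa using (he.add (hs 0)).sub (ha 0)
    have h1 : ∀ᶠ m in u, e m + sm m 0 - am m 0 < s 0 - a 0 + 1 :=
      hd.eventually (gt_mem_nhds (by linarith))
    have h2 : ∀ᶠ m in u, ∀ j : Fin l, sm m j.succ < κ j.succ :=
      eventually_all.2 fun j => (hs j.succ).eventually (gt_mem_nhds (hsl j))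
    have h3 : ∀ᶠ m in u, sm m j.succ < κ j.succ - γ :=
      (hs j.succ).eventually (gt_mem_nhds (by simp only [hγ]; have := hsl j; linarith))
    filter_upwards [h1, h2, h3] with m h1 h2 h3
    have hi := hsi m
    rw [Fin.sum_univ_succ, Fin.sum_univ_succ, h0, one_mul, one_mul] at hi
    have hterm : ∀ j : Fin l, 0 ≤ lam m j.succ * am m j.succ - lam m j.succ * sm m j.succ := by
      intro j
      have := mul_le_mul_of_nonneg_left (h2 j).le (hlam0 m j)
      linarith [hlamk m j]
    have hsg := Finset.single_le_sum (f := fun j : Fin l =>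
      lam m j.succ * am m j.succ - lam m j.succ * sm m j.succ) (fun j _ => hterm j)
      (Finset.mem_univ j)
    rw [Finset.sum_sub_distrib] at hsg
    rw [le_div_iff₀ hγ0]
    have h5 := mul_le_mul_of_nonneg_left h3.le (hlam0 m j)
    have h6 := hlamk m j
    linarith
  choose B hB using hB
  constructor
  · intro j
    by_contra hcon
    push Not at hcon
    set δ := (a j.succ - κ j.succ) / 2 with hδ
    have hδ0 : 0 < δ := by simp only [hδ]; linarith
    have h1 : ∀ᶠ m in u, κ j.succ + δ < am m j.succ :=
      (ha j.succ).eventually (lt_mem_nhds (by simp only [hδ]; linarith))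
    have h2 : ∀ᶠ m : ℕ in u, B j / δ < (m : ℝ) :=
      (tendsto_natCast_atTop_atTop.mono_left hu).eventually (eventually_gt_atTop _)
    obtain ⟨m, h1, h2, h3⟩ := (h1.and (h2.and (hB j))).exists
    rw [hl] at h3
    rw [div_lt_iff₀ hδ0] at h2
    have : δ ≤ max (am m j.succ - κ j.succ) 0 := le_max_of_le_left (by linarith)
    have := mul_le_mul_of_nonneg_left this (Nat.cast_nonneg (α := ℝ) m)
    linarith
  · intro bm b hb hi hbk
    have hlim : Tendsto (fun m => bm m 0 + ∑ j : Fin l, |B j| * max (bm m j.succ - κ j.succ) 0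
        + e m) u (𝓝 (b 0 + ∑ j : Fin l, |B j| * max (b j.succ - κ j.succ) 0 + 0)) := by
      refine ((hb 0).add (tendsto_finsetSum _ fun j _ => ?_)).add he
      exact (((hb j.succ).sub_const _).max tendsto_const_nhds).const_mul _
    have hz : ∑ j : Fin l, |B j| * max (b j.succ - κ j.succ) 0 = 0 :=
      Finset.sum_eq_zero fun j _ => by
        rw [max_eq_right (by linarith [hbk j]), mul_zero]
    rw [hz, add_zero, add_zero] at hlim
    refine le_of_tendsto_of_tendsto (ha 0) hlim ?_
    filter_upwards [eventually_all.2 hB] with m hBm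
    have hi := hi m
    rw [Fin.sum_univ_succ, Fin.sum_univ_succ, h0, one_mul, one_mul] at hi
    have : ∑ j : Fin l, lam m j.succ * bm m j.succ - ∑ j : Fin l, lam m j.succ * am m j.succ ≤
        ∑ j : Fin l, |B j| * max (bm m j.succ - κ j.succ) 0 := by
      rw [← Finset.sum_sub_distrib]
      refine Finset.sum_le_sum fun j _ => ?_
      have e1 := hlamk m j
      have e2 := mul_le_mul_of_nonneg_left (le_max_left (bm m j.succ - κ j.succ) 0) (hlam0 m j)
      have e3 := mul_le_mul_of_nonneg_right ((hBm j).trans (le_abs_self _))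
        (le_max_right (bm m j.succ - κ j.succ) 0)
      nlinarith
    linarith

theorem main_exists (w : X → ℝ) (hA : AssumptionA G) (hB : AssumptionB G w)
    (hC : AssumptionC G) : ∃ φ : StatProfile G, IsNashStat G φ := by
  classical
  obtain ⟨enc, henc⟩ := exists_injective_nat X
  have hfin : ∀ m : ℕ, {x : X | enc x ≤ m}.Finite := fun m =>
    (Set.finite_Iic m).preimage henc.injOn
  let S : ℕ → Finset X := fun m => (hfin m).toFinset
  have hS : ∀ y, ∀ᶠ m in (hyperfilter ℕ : Filter ℕ), y ∈ S m := fun y =>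
    Nat.hyperfilter_le_atTop (by
      filter_upwards [eventually_ge_atTop (enc y)] with m hm
      simpa [S] using hm)
  choose φm hφm using fun m : ℕ => level G hA hB (S m) m (Nat.cast_nonneg m) (1 / ((m : ℝ) + 1))
    (by positivity)
  obtain ⟨φ, hφ⟩ := exists_limit G (hyperfilter ℕ) φm
  have hconst : ∀ i ℓ, Tendsto (fun m => JS G (S m) i ℓ fun _ => φm m) (hyperfilter ℕ)
      (𝓝 (J G i ℓ (ofStatAll G φ))) := fun i ℓ =>
    J_conv G hA hB (hyperfilter ℕ : Filter ℕ) (fun m _ => φm m) (fun _ => φ)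
      (fun _ i x => hφ i x) S hS (G.c i ℓ) (hA.2 i ℓ) (hB.2.1 i ℓ)
  have hdev : ∀ i ℓ (ψ : ℕ → Stat G i),
      Tendsto (fun m => JS G (S m) i ℓ fun t => Function.update (φm m) i (ψ t)) (hyperfilter ℕ)
      (𝓝 (Jfun G G.η (G.c i ℓ) (ofMarkov G fun t => Function.update φ i (ψ t)))) := fun i ℓ ψ =>
    J_conv G hA hB (hyperfilter ℕ : Filter ℕ) (fun m t => Function.update (φm m) i (ψ t))
      (fun t => Function.update φ i (ψ t))
      (fun t j x => by
        rcases eq_or_ne j i with rfl | hj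
        · simp only [Function.update_self]; exact tendsto_const_nhds
        · simp only [Function.update_of_ne hj]; exact hφ j x)
      S hS (G.c i ℓ) (hA.2 i ℓ) (hB.2.1 i ℓ)
  have he : Tendsto (fun m : ℕ => 1 / ((m : ℝ) + 1) / (1 - G.α)) (hyperfilter ℕ) (𝓝 0) := by
    have := (tendsto_one_div_add_atTop_nhds_zero_nat (𝕜 := ℝ)).div_const (1 - G.α)
    rw [zero_div] at this
    exact this.mono_left Nat.hyperfilter_le_atTop
  have hred : ∀ i (σ : Strategy G i), ∃ ψ : ℕ → Stat G i, ∀ ℓ,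
      J G i ℓ (combine G (ofStatAll G φ) i σ) =
        Jfun G G.η (G.c i ℓ) (ofMarkov G fun t => Function.update φ i (ψ t)) := by
    intro i σ
    obtain ⟨ψ, hψ⟩ := markov_reduction G φ i σ w fun t => B_int G hB _ t
    exact ⟨ψ, fun ℓ => hψ _ (G.hc i ℓ) (hB.2.1 i ℓ)⟩
  choose σs hσs using hC φ
  choose ψs hψs using fun i => hred i (σs i)
  have key := fun i =>
    final_real (hyperfilter ℕ : Filter ℕ) Nat.hyperfilter_le_atTop (G.κ i)
      (fun m ℓ => JS G (S m) i ℓ fun _ => φm m) (fun ℓ => J G i ℓ (ofStatAll G φ)) (hconst i)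
      (fun m ℓ => lm G m i ℓ (JS G (S m) i ℓ fun _ => φm m)) (fun m => by simp [lm])
      (fun m j => by simp [lm, Fin.succ_ne_zero]) _ he
      (fun m ℓ => JS G (S m) i ℓ fun t => Function.update (φm m) i (ψs i t)) _
      (fun ℓ => hdev i ℓ (ψs i))
      (fun j => by rw [← hψs]; exact hσs i _ (Fin.succ_ne_zero j))
      (fun m => hφm m i (ψs i))
  refine ⟨φ, fun i ℓ hℓ => ?_, fun i σ hσ => ?_⟩
  · obtain ⟨j, rfl⟩ := Fin.exists_succ_eq.2 hℓ
    exact (key i).1 j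
  · obtain ⟨ψ, hψ⟩ := hred i σ
    have h := (key i).2 (fun m ℓ => JS G (S m) i ℓ fun t => Function.update (φm m) i (ψ t)) _
      (fun ℓ => hdev i ℓ ψ) (fun m => hφm m i ψ)
      (fun j => by rw [← hψ]; exact hσ _ (Fin.succ_ne_zero j))
    rw [hψ]
    exact h

end Final

end CSGame

open CSGame

namespace CSGame

variable {n l : ℕ}
variable {X : Type} [Countable X] [MeasurableSpace X] [DiscreteMeasurableSpace X]
  [TopologicalSpace X] [DiscreteTopology X] [BorelSpace X] [SecondCountableTopology X]
variable {A : Fin n → Type} [∀ i, MeasurableSpace (A i)] [∀ i, TopologicalSpace (A i)]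
  [∀ i, PolishSpace (A i)] [∀ i, BorelSpace (A i)]
variable (G : GameData n l X A)

/-- Theorem 1. -/
theorem stmt0 (w : X → ℝ) (hA : AssumptionA G) (hB : AssumptionB G w)
    (hC : AssumptionC G) :
    ∃ φ : StatProfile G, IsNashStat G φ := by
  exact main_exists G w hA hB hC


end CSGame
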